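/- arXiv:2406.14700 — 2 statements merged into one kernel-verified Lean document; each statement's English description precedes it below -/
import Mathlib

section
/- The function s is differentiable at the point p_0, and its derivative there satisfies s'(p_0) > 0. -/
/-- `v p n` is the optimal expected number of heads in the coin game with `n` coins,
each landing heads with probability `p`. -/
noncomputable def v (p : ℝ) : ℕ → ℝ
  | 0 => 0
  | n + 1 =>
      ((n : ℝ) + 1) * p ^ (n + 1) + v p n * (1 - p) ^ (n + 1) +
        ∑ j ∈ (Finset.Icc 1 n).attach,
          (((n + 1).choose j.1 : ℕ) : ℝ) * p ^ (j.1 : ℕ) * (1 - p) ^ (n + 1 - j.1) *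
            ((Finset.Icc 1 j.1).attach.sup'
              (Finset.attach_nonempty_iff.mpr
                (Finset.nonempty_Icc.mpr (Finset.mem_Icc.mp j.2).1))
              (fun i => v p (n + 1 - i.1) + (i.1 : ℝ)))
decreasing_by
  · omega
  · have h := (Finset.mem_Icc.mp i.2).1
    omega

/-- `s p n = v p n - n + 1 - p`. -/
noncomputable def s (p : ℝ) (n : ℕ) : ℝ := v p n - n + 1 - p


namespace CoinGame

/-- Probability of exactly one tail among `m + 2` coins. -/
noncomputable def oneTail (p : ℝ) (m : ℕ) : ℝ := ((m : ℝ) + 2) * p ^ (m + 1) * (1 - p)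

/-- Probability of at most one tail among `m + 2` coins. -/
noncomputable def atMostOneTail (p : ℝ) (m : ℕ) : ℝ := p ^ (m + 2) + oneTail p m

/-- The inhomogeneous term of the recursion for `surplus`. -/
noncomputable def drift (p : ℝ) (m : ℕ) : ℝ := p ^ (m + 2) * (1 - p) - (1 - p) ^ (m + 2)

/-- The value of `s p (m + 1)` when exactly one head is set aside in each round, except that
a toss with a single tail also allows one to continue with a single coin. -/
noncomputable def surplus (p : ℝ) : ℕ → ℝ
  | 0 => 0
  | m + 1 => (1 - atMostOneTail p m) * surplus p m + oneTail p m * max (surplus p m) 0 + drift p m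

theorem surplus_succ (p : ℝ) (m : ℕ) : surplus p (m + 1) =
    (1 - atMostOneTail p m) * surplus p m + oneTail p m * max (surplus p m) 0 + drift p m := rfl

theorem surplus_succ_of_nonpos {p : ℝ} {m : ℕ} (h : surplus p m ≤ 0) :
    surplus p (m + 1) = (1 - atMostOneTail p m) * surplus p m + drift p m := by
  rw [surplus_succ, max_eq_right h]; ring

theorem surplus_succ_of_nonneg {p : ℝ} {m : ℕ} (h : 0 ≤ surplus p m) :
    surplus p (m + 1) = (1 - p ^ (m + 2)) * surplus p m + drift p m := by
  rw [surplus_succ, max_eq_left h, atMostOneTail]; ring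

theorem surplus_one (p : ℝ) : surplus p 1 = p ^ 2 * (1 - p) - (1 - p) ^ 2 := by
  simp [surplus, drift]

theorem oneTail_nonneg {p : ℝ} (h0 : 0 ≤ p) (h1 : p ≤ 1) (m : ℕ) : 0 ≤ oneTail p m := by
  have : 0 ≤ 1 - p := by linarith
  unfold oneTail; positivity

theorem atMostOneTail_nonneg {p : ℝ} (h0 : 0 ≤ p) (h1 : p ≤ 1) (m : ℕ) :
    0 ≤ atMostOneTail p m :=
  add_nonneg (by positivity) (oneTail_nonneg h0 h1 m)

theorem atMostOneTail_lt_one {p : ℝ} (h0 : 0 ≤ p) (h1 : p < 1) (m : ℕ) :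
    atMostOneTail p m < 1 := by
  induction m with
  | zero => simp only [atMostOneTail, oneTail]; norm_num; nlinarith
  | succ m ih =>
    refine lt_of_le_of_lt ?_ ih
    have : atMostOneTail p m - atMostOneTail p (m + 1) = (m + 2) * p ^ (m + 1) * (1 - p) ^ 2 := by
      simp only [atMostOneTail, oneTail]; push_cast; ring
    have : 0 ≤ (m + 2) * p ^ (m + 1) * (1 - p) ^ 2 := by positivity
    linarith

/-- An interval around the zero of the limit of `surplus`. -/
abbrev window : Set ℝ := Set.Icc (27 / 50) (14 / 25)

theorem surplus_one_bounds {p : ℝ} (hp : p ∈ window) :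
    -2 / 25 ≤ surplus p 1 ∧ surplus p 1 ≤ -(1 - p) * (79 / 625) := by
  obtain ⟨h1, h2⟩ := hp
  have e : surplus p 1 = (1 - p) * (p ^ 2 - (1 - p)) := by rw [surplus_one]; ring
  rw [e]
  have ha : p ^ 2 - (1 - p) ≤ -(79 / 625) := by nlinarith
  have hb : -(17 / 100) ≤ p ^ 2 - (1 - p) := by nlinarith
  constructor <;> nlinarith

theorem atMostOneTail_one_bounds {p : ℝ} (hp : p ∈ window) :
    111 / 200 ≤ atMostOneTail p 1 ∧ atMostOneTail p 1 ≤ 61 / 100 := by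
  obtain ⟨h1, h2⟩ := hp
  have l : (27 / 50 : ℝ) ^ 2 ≤ p ^ 2 := by gcongr
  have u : p ^ 2 ≤ (14 / 25 : ℝ) ^ 2 := by gcongr
  have c1 : atMostOneTail p 1 = p ^ 2 * (3 - 2 * p) := by
    simp only [atMostOneTail, oneTail]; push_cast; ring
  rw [c1]
  constructor <;> nlinarith

theorem atMostOneTail_two_bounds {p : ℝ} (hp : p ∈ window) :
    36 / 100 ≤ atMostOneTail p 2 ∧ atMostOneTail p 2 ≤ 59 / 100 := by
  obtain ⟨h1, h2⟩ := hp
  have l : (27 / 50 : ℝ) ^ 3 ≤ p ^ 3 := by gcongr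
  have u : p ^ 3 ≤ (14 / 25 : ℝ) ^ 3 := by gcongr
  have c1 : atMostOneTail p 2 = p ^ 3 * (4 - 3 * p) := by
    simp only [atMostOneTail, oneTail]; push_cast; ring
  rw [c1]
  constructor <;> nlinarith

theorem drift_one_bounds {p : ℝ} (hp : p ∈ window) :
    (1 - p) * -(55 / 1000) ≤ drift p 1 ∧ drift p 1 ≤ -(7 / 1000) := by
  obtain ⟨h1, h2⟩ := hp
  have q0 : 11 / 25 ≤ 1 - p := by linarith
  have l : (27 / 50 : ℝ) ^ 3 ≤ p ^ 3 := by gcongr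
  have u : p ^ 3 ≤ (14 / 25 : ℝ) ^ 3 := by gcongr
  have ql : (11 / 25 : ℝ) ^ 2 ≤ (1 - p) ^ 2 := by gcongr
  have qu : (1 - p) ^ 2 ≤ (23 / 50 : ℝ) ^ 2 := by gcongr; linarith
  have e : drift p 1 = (1 - p) * (p ^ 3 - (1 - p) ^ 2) := by unfold drift; ring
  have hl : -(55 / 1000) ≤ p ^ 3 - (1 - p) ^ 2 := by linarith
  have hu : p ^ 3 - (1 - p) ^ 2 ≤ -(17 / 1000) := by linarith
  rw [e]
  generalize p ^ 3 - (1 - p) ^ 2 = x at *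
  constructor <;> nlinarith

theorem drift_two_bounds {p : ℝ} (hp : p ∈ window) :
    -(6 / 1000) ≤ drift p 2 ∧ drift p 2 ≤ 7 / 1000 := by
  obtain ⟨h1, h2⟩ := hp
  have q0 : 11 / 25 ≤ 1 - p := by linarith
  have l : (27 / 50 : ℝ) ^ 4 ≤ p ^ 4 := by gcongr
  have u : p ^ 4 ≤ (14 / 25 : ℝ) ^ 4 := by gcongr
  have ql : (11 / 25 : ℝ) ^ 3 ≤ (1 - p) ^ 3 := by gcongr
  have qu : (1 - p) ^ 3 ≤ (23 / 50 : ℝ) ^ 3 := by gcongr; linarith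
  have e : drift p 2 = (1 - p) * (p ^ 4 - (1 - p) ^ 3) := by unfold drift; ring
  have hl : -(13 / 1000) ≤ p ^ 4 - (1 - p) ^ 3 := by linarith
  have hu : p ^ 4 - (1 - p) ^ 3 ≤ 14 / 1000 := by linarith
  rw [e]
  generalize p ^ 4 - (1 - p) ^ 3 = x at *
  constructor <;> nlinarith

theorem surplus_two_three {p : ℝ} (hp : p ∈ window) :
    surplus p 1 < surplus p 2 ∧ surplus p 2 < surplus p 3 ∧ surplus p 3 < 0 := by
  have e1 := (surplus_one_bounds hp).2
  obtain ⟨c1l, c1u⟩ := atMostOneTail_one_bounds hp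
  obtain ⟨c2l, c2u⟩ := atMostOneTail_two_bounds hp
  obtain ⟨d1l, d1u⟩ := drift_one_bounds hp
  obtain ⟨d2l, d2u⟩ := drift_two_bounds hp
  have q0 : 11 / 25 ≤ 1 - p := by linarith [hp.2]
  have f2 : surplus p 2 = _ := surplus_succ_of_nonpos (p := p) (m := 1) (by linarith)
  have s2 : surplus p 2 ≤ -(27 / 1000) := by rw [f2]; nlinarith
  have f3 : surplus p 3 = _ := surplus_succ_of_nonpos (p := p) (m := 2) (by linarith)
  refine ⟨?_, ?_, ?_⟩
  · rw [f2]; nlinarith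
  · rw [f3]; nlinarith
  · rw [f3]; nlinarith

theorem drift_pos {p : ℝ} (hp : p ∈ window) (m : ℕ) : 0 < drift p (m + 3) := by
  obtain ⟨h1, h2⟩ := hp
  have q0 : 0 < 1 - p := by linarith
  have h4 : (1 - p) ^ 4 < p ^ 5 := calc
    (1 - p) ^ 4 ≤ (23 / 50) ^ 4 := by gcongr; linarith
    _ < (27 / 50) ^ 5 := by norm_num
    _ ≤ p ^ 5 := by gcongr
  have hm : (1 - p) ^ m ≤ p ^ m := by gcongr; linarith
  have : (1 - p) ^ 4 * (1 - p) ^ m < p ^ 5 * p ^ m :=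
    mul_lt_mul h4 hm (by positivity) (by positivity)
  have e : drift p (m + 3) = (1 - p) * (p ^ 5 * p ^ m - (1 - p) ^ 4 * (1 - p) ^ m) := by
    unfold drift; ring
  rw [e]
  exact mul_pos q0 (by linarith)

theorem pow_mul_surplus_lt_drift {p : ℝ} (hp : p ∈ window) (m : ℕ) :
    p ^ (m + 5) * surplus p (m + 3) < drift p (m + 3) := by
  have h1 : 27 / 50 ≤ p := hp.1
  have h2 : p ≤ 14 / 25 := hp.2
  have p0 : 0 < p := by linarith
  induction m with
  | zero =>
    have := (surplus_two_three hp).2.2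
    have := drift_pos hp 0
    have : p ^ 5 * surplus p 3 < 0 := mul_neg_of_pos_of_neg (by positivity) (by assumption)
    simpa using by linarith
  | succ m ih =>
    have hd := drift_pos hp m
    have key : p ^ (m + 5) * surplus p (m + 4) ≤ drift p (m + 3) := by
      have hq1 : p ^ (m + 5) ≤ 1 := pow_le_one₀ p0.le (by linarith)
      have hq0 : 0 < p ^ (m + 5) := by positivity
      rcases le_total (surplus p (m + 3)) 0 with h | h
      · rw [surplus_succ_of_nonpos h]
        have := atMostOneTail_lt_one p0.le (by linarith) (m + 3)
        nlinarith [mul_nonneg (sub_nonneg.2 this.le) (neg_nonneg.2 h)]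
      · rw [surplus_succ_of_nonneg h]
        change p ^ (m + 5) * ((1 - p ^ (m + 5)) * surplus p (m + 3) + drift p (m + 3)) ≤ _
        nlinarith
    have e : drift p (m + 1 + 3) - p * drift p (m + 3) = (1 - p) ^ (m + 5) * (2 * p - 1) := by
      unfold drift; ring
    have : 0 < (1 - p) ^ (m + 5) * (2 * p - 1) :=
      mul_pos (pow_pos (by linarith) _) (by linarith)
    calc p ^ (m + 1 + 5) * surplus p (m + 1 + 3)
      = p * (p ^ (m + 5) * surplus p (m + 4)) := by ring_nf
      _ ≤ p * drift p (m + 3) := by gcongr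
      _ < drift p (m + 1 + 3) := by linarith

theorem surplus_lt_succ {p : ℝ} (hp : p ∈ window) (m : ℕ) :
    surplus p (m + 1) < surplus p (m + 2) := by
  obtain _ | _ | m := m
  · exact (surplus_two_three hp).1
  · exact (surplus_two_three hp).2.1
  · have h1 : 27 / 50 ≤ p := hp.1
    have h2 : p ≤ 14 / 25 := hp.2
    change surplus p (m + 3) < surplus p (m + 4)
    rcases le_total (surplus p (m + 3)) 0 with h | h
    · rw [surplus_succ_of_nonpos h]
      have := atMostOneTail_nonneg (p := p) (by linarith) (by linarith) (m + 3)
      nlinarith [mul_nonneg this (neg_nonneg.2 h), drift_pos hp m]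
    · rw [surplus_succ_of_nonneg h]
      have := pow_mul_surplus_lt_drift hp m
      change _ < (1 - p ^ (m + 5)) * surplus p (m + 3) + drift p (m + 3)
      linarith

theorem surplus_strictMono {p : ℝ} (hp : p ∈ window) :
    StrictMono fun m => surplus p (m + 1) :=
  strictMono_nat_of_lt_succ (surplus_lt_succ hp)

theorem abs_surplus_le_one {p : ℝ} (hp : p ∈ window) (m : ℕ) : |surplus p m| ≤ 1 := by
  have h1 : 27 / 50 ≤ p := hp.1
  have h2 : p ≤ 14 / 25 := hp.2
  obtain _ | m := m
  · simp [surplus]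
  rw [abs_le]
  constructor
  · have h : surplus p 1 ≤ surplus p (m + 1) := (surplus_strictMono hp).monotone (Nat.zero_le m)
    linarith [(surplus_one_bounds hp).1]
  · have h : surplus p (m + 1) ≤ surplus p (m + 3) :=
      (surplus_strictMono hp).monotone (by lia : m ≤ m + 2)
    refine h.trans ?_
    have h3 := pow_mul_surplus_lt_drift hp m
    have hq : 0 < (1 - p) ^ (m + 5) := pow_pos (by linarith) _
    have hpp : 0 < p ^ (m + 5) := pow_pos (by linarith) _
    have : drift p (m + 3) ≤ p ^ (m + 5) * 1 := by
      unfold drift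
      nlinarith
    exact le_of_mul_le_mul_left (h3.le.trans this) hpp

theorem s_one (p : ℝ) : s p 1 = 0 := by
  have h : v p 1 = p := by
    rw [v, Finset.sum_eq_zero fun j _ => by simpa using j.2]
    simp [v]
  simp [s, h]

theorem sum_Icc_binomial (p : ℝ) (n : ℕ) :
    ∑ j ∈ Finset.Icc 1 n, ((n + 1).choose j : ℝ) * p ^ j * (1 - p) ^ (n + 1 - j) =
      1 - p ^ (n + 1) - (1 - p) ^ (n + 1) := by
  have h := add_pow p (1 - p) (n + 1)
  rw [Finset.sum_range_succ, Finset.sum_range_succ'] at h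
  have e : ∑ j ∈ Finset.Icc 1 n, ((n + 1).choose j : ℝ) * p ^ j * (1 - p) ^ (n + 1 - j) =
      ∑ k ∈ Finset.range n,
        p ^ (k + 1) * (1 - p) ^ (n + 1 - (k + 1)) * ((n + 1).choose (k + 1) : ℝ) := by
    rw [Finset.range_eq_Ico, Finset.sum_Ico_add' (fun k =>
      p ^ k * (1 - p) ^ (n + 1 - k) * ((n + 1).choose k : ℝ)) 0 n 1]
    exact Finset.sum_congr (by ext; simp) fun _ _ => by ring
  rw [e]
  simp at h ⊢
  linarith

theorem sup_v_eq {p : ℝ} {n : ℕ} (h : ∀ k, 2 ≤ k → k ≤ n → s p k ≤ s p n) {j : ℕ}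
    (hj : j ∈ Finset.Icc 1 n) (hne : (Finset.Icc 1 j).attach.Nonempty) :
    (Finset.Icc 1 j).attach.sup' hne (fun i => v p (n + 1 - i.1) + (i.1 : ℝ)) =
      s p n + n + p + if j = n then max (s p n) 0 - s p n else 0 := by
  obtain ⟨hj1, hjn⟩ := Finset.mem_Icc.1 hj
  have hv : ∀ i, 1 ≤ i → i ≤ n → v p (n + 1 - i) + (i : ℝ) = s p (n + 1 - i) + n + p := by
    intro i h1 h2
    rw [s, Nat.cast_sub (by lia)]
    push_cast
    ring
  apply le_antisymm
  · refine Finset.sup'_le _ _ fun i _ => ?_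
    obtain ⟨hi1, hij⟩ := Finset.mem_Icc.1 i.2
    rw [hv _ hi1 (hij.trans hjn)]
    split_ifs with hjn'
    · rcases eq_or_lt_of_le (hij.trans hjn) with hi | hi
      · rw [hi, Nat.add_sub_cancel_left, s_one]
        linarith [le_max_right (s p n) 0]
      · linarith [le_max_left (s p n) 0, h (n + 1 - i) (by lia) (by lia)]
    · linarith [h (n + 1 - i) (by lia) (by lia)]
  · have hle : ∀ i ∈ Finset.Icc 1 j, s p (n + 1 - i) + n + p ≤ (Finset.Icc 1 j).attach.sup' hne
        (fun i => v p (n + 1 - i.1) + (i.1 : ℝ)) := by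
      intro i hi
      rw [← hv i (Finset.mem_Icc.1 hi).1 ((Finset.mem_Icc.1 hi).2.trans hjn)]
      exact Finset.le_sup' (fun i : Finset.Icc 1 j => v p (n + 1 - i.1) + (i.1 : ℝ))
        (Finset.mem_attach _ ⟨i, hi⟩)
    have h1 := hle 1 (Finset.mem_Icc.2 ⟨le_rfl, hj1⟩)
    rw [Nat.add_sub_cancel] at h1
    split_ifs with hjn'
    · have h2 := hle j (Finset.mem_Icc.2 ⟨hj1, le_rfl⟩)
      rw [show n + 1 - j = 1 by lia, s_one] at h2
      rcases max_choice (s p n) 0 with hm | hm <;> rw [hm] <;> linarith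
    · linarith

theorem s_add_two {p : ℝ} {m : ℕ} (h : ∀ k, 2 ≤ k → k ≤ m + 1 → s p k ≤ s p (m + 1)) :
    s p (m + 2) = (1 - atMostOneTail p m) * s p (m + 1) + oneTail p m * max (s p (m + 1)) 0 +
      drift p m := by
  have hv : v p (m + 1) = s p (m + 1) + (m + 1) - 1 + p := by simp [s]; ring
  have key : v p (m + 2) = ((m : ℝ) + 2) * p ^ (m + 2) + v p (m + 1) * (1 - p) ^ (m + 2) +
      ∑ j ∈ Finset.Icc 1 (m + 1), ((m + 2).choose j : ℝ) * p ^ j * (1 - p) ^ (m + 2 - j) *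
        (s p (m + 1) + (m + 1) + p +
          if j = m + 1 then max (s p (m + 1)) 0 - s p (m + 1) else 0) := by
    rw [v, ← Finset.sum_attach (Finset.Icc 1 (m + 1))]
    congr 1
    · push_cast; ring
    · refine Finset.sum_congr rfl fun j _ => ?_
      rw [sup_v_eq h j.2]
      push_cast
      ring
  have hs : s p (m + 2) = v p (m + 2) - (m + 2) + 1 - p := by simp [s]
  rw [hs, key, hv]
  simp only [mul_add, Finset.sum_add_distrib, ← Finset.sum_mul, sum_Icc_binomial, mul_ite, mul_zero,
    Finset.sum_ite_eq', Finset.mem_Icc, le_refl, and_true, Nat.le_add_left, if_true]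
  rw [show m + 2 - (m + 1) = 1 by lia, Nat.choose_succ_self_right]
  simp only [atMostOneTail, oneTail, drift]
  push_cast
  ring

theorem s_succ_eq_surplus {p : ℝ} (hp : p ∈ window) (m : ℕ) : s p (m + 1) = surplus p m := by
  induction m using Nat.strong_induction_on with
  | _ m ih =>
    obtain _ | m := m
    · exact s_one p
    · rw [s_add_two, ih m (by lia), surplus_succ]
      intro k h2 hk
      obtain ⟨k, rfl⟩ : ∃ l, k = l + 2 := ⟨k - 2, by lia⟩
      obtain ⟨m, rfl⟩ : ∃ l, m = l + 1 := ⟨m - 1, by lia⟩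
      rw [ih (k + 1) (by lia), ih (m + 1) (by lia)]
      exact (surplus_strictMono hp).monotone (by lia)

theorem surplus_succ_ge {p : ℝ} (h0 : 0 ≤ p) (h1 : p ≤ 1) (m : ℕ) :
    (1 - atMostOneTail p m) * surplus p m + drift p m ≤ surplus p (m + 1) := by
  rw [surplus_succ]
  have := mul_nonneg (oneTail_nonneg h0 h1 m) (le_max_right (surplus p m) 0)
  linarith

theorem surplus_right_pos : 0 < surplus (14 / 25) 5 := by
  have h0 : surplus (14 / 25) 0 = 0 := rfl
  have h1 := surplus_succ_ge (p := 14 / 25) (by norm_num) (by norm_num) 0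
  have h2 := surplus_succ_ge (p := 14 / 25) (by norm_num) (by norm_num) 1
  have h3 := surplus_succ_ge (p := 14 / 25) (by norm_num) (by norm_num) 2
  have h4 := surplus_succ_ge (p := 14 / 25) (by norm_num) (by norm_num) 3
  have h5 := surplus_succ_ge (p := 14 / 25) (by norm_num) (by norm_num) 4
  norm_num [atMostOneTail, oneTail, drift, h0] at h1 h2 h3 h4 h5
  linarith

theorem surplus_left_bounds :
    surplus (27 / 50) 6 ≤ -(208 / 10000) ∧ -(21 / 1000) ≤ surplus (27 / 50) 6 := by
  have hp : (27 / 50 : ℝ) ∈ window := by norm_num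
  have hneg : ∀ m, m ≤ 2 → surplus (27 / 50) (m + 1) ≤ 0 := fun m hm =>
    ((surplus_strictMono hp).monotone hm).trans (surplus_two_three hp).2.2.le
  have h1 := surplus_one (27 / 50)
  have h2 := surplus_succ_of_nonpos (hneg 0 (by lia))
  have h3 := surplus_succ_of_nonpos (hneg 1 (by lia))
  have h4 := surplus_succ_of_nonpos (hneg 2 (by lia))
  norm_num [atMostOneTail, oneTail, drift] at h1 h2 h3 h4
  rw [h1] at h2
  rw [h2] at h3
  rw [h3] at h4
  have h5 := surplus_succ_of_nonpos (p := 27 / 50) (m := 4) (by rw [h4]; norm_num)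
  norm_num [atMostOneTail, oneTail, drift, h4] at h5
  have h6 := surplus_succ_of_nonpos (p := 27 / 50) (m := 5) (by rw [h5]; norm_num)
  norm_num [atMostOneTail, oneTail, drift, h5] at h6
  rw [h6]
  norm_num

theorem surplus_left_le_barrier (m : ℕ) : surplus (27 / 50) (m + 6) ≤
    -(1 / 100 + (21 / 1000 * (m + 7) + 611 / 1000) * (27 / 50) ^ (m + 7)) := by
  have hp : (27 / 50 : ℝ) ∈ window := by norm_num
  induction m with
  | zero =>
    refine surplus_left_bounds.1.trans ?_
    norm_num
  | succ m ih =>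
    have hx : (0 : ℝ) < (27 / 50) ^ (m + 7) := by positivity
    have hmx : 0 ≤ (m : ℝ) * (27 / 50) ^ (m + 7) := by positivity
    have hneg : surplus (27 / 50) (m + 6) ≤ 0 := by linarith
    have hlow : -(21 / 1000) ≤ surplus (27 / 50) (m + 6) :=
      surplus_left_bounds.2.trans ((surplus_strictMono hp).monotone (by lia : 5 ≤ m + 5))
    have hc := mul_le_mul_of_nonneg_left (neg_le.1 hlow)
      (atMostOneTail_nonneg (p := 27 / 50) (by norm_num) (by norm_num) (m + 6))
    have hd : drift (27 / 50) (m + 6) ≤ (27 / 50) ^ (m + 8) * (23 / 50) := by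
      have : (0 : ℝ) ≤ (1 - 27 / 50) ^ (m + 8) := by positivity
      unfold drift
      linarith
    have hstep := surplus_succ_of_nonpos hneg
    have hcv : atMostOneTail (27 / 50) (m + 6) =
        (27 / 50 : ℝ) ^ (m + 7) * (27 / 50 + (m + 8) * (23 / 50)) := by
      simp only [atMostOneTail, oneTail]; push_cast; ring
    rw [show m + 1 + 6 = m + 6 + 1 by lia, hstep]
    rw [hcv] at hc ⊢
    rw [show m + 8 = m + 7 + 1 by lia, pow_succ _ (m + 7)] at hd
    rw [show m + 1 + 7 = m + 7 + 1 by lia, pow_succ _ (m + 7)]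
    push_cast
    linarith

/-- A summable majorant for the coefficients of the recursion and their Lipschitz constants. -/
noncomputable def coeffBound (m : ℕ) : ℝ := ((m : ℝ) + 2) ^ 2 * (14 / 25) ^ m

theorem coeffBound_nonneg (m : ℕ) : 0 ≤ coeffBound m := by unfold coeffBound; positivity

theorem summable_coeffBound : Summable coeffBound := by
  have h (k : ℕ) : Summable fun n : ℕ => (n : ℝ) ^ k * (14 / 25 : ℝ) ^ n :=
    summable_pow_mul_geometric_of_norm_lt_one k (by norm_num)
  refine (((h 2).add ((h 1).mul_left 4)).add ((h 0).mul_left 4)).congr fun m => ?_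
  unfold coeffBound
  ring

theorem pow_le_of_mem_window {p : ℝ} (hp : p ∈ window) (m : ℕ) : p ^ m ≤ (14 / 25) ^ m :=
  pow_le_pow_left₀ (by linarith [hp.1]) hp.2 m

theorem one_sub_pow_le_of_mem_window {p : ℝ} (hp : p ∈ window) (m : ℕ) :
    (1 - p) ^ m ≤ (14 / 25) ^ m :=
  pow_le_pow_left₀ (by linarith [hp.2]) (by linarith [hp.1]) m

theorem atMostOneTail_le_coeffBound {p : ℝ} (hp : p ∈ window) (m : ℕ) :
    atMostOneTail p m ≤ coeffBound m := by
  have h0 : 0 ≤ p := by linarith [hp.1]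
  have h1 : p ≤ 1 := by linarith [hp.2]
  have hx := pow_le_of_mem_window hp m
  have hx0 : 0 ≤ p ^ m := by positivity
  have e : atMostOneTail p m = p ^ m * (p * (p + (m + 2) * (1 - p))) := by
    simp only [atMostOneTail, oneTail]; ring
  have hm : (0 : ℝ) ≤ m := by positivity
  have hb : p + (m + 2) * (1 - p) ≤ (m + 2) := by nlinarith
  have hb0 : 0 ≤ p + (m + 2) * (1 - p) := by
    have : 0 ≤ 1 - p := by linarith
    positivity
  have hc : p * (p + (m + 2) * (1 - p)) ≤ ((m : ℝ) + 2) ^ 2 := by nlinarith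
  rw [e, coeffBound, mul_comm]
  gcongr

theorem oneTail_le_coeffBound {p : ℝ} (hp : p ∈ window) (m : ℕ) : oneTail p m ≤ coeffBound m := by
  have : 0 ≤ p ^ (m + 2) := pow_nonneg (by linarith [hp.1]) _
  have h := atMostOneTail_le_coeffBound hp m
  unfold atMostOneTail at h
  linarith

theorem hasDerivAt_one_sub_pow (p : ℝ) (n : ℕ) :
    HasDerivAt (fun p : ℝ => (1 - p) ^ (n + 1)) (-((n + 1) * (1 - p) ^ n)) p := by
  have h := ((hasDerivAt_id p).const_sub 1).fun_pow (n + 1)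
  simpa using h

theorem hasDerivAt_oneTail (p : ℝ) (m : ℕ) : HasDerivAt (fun p => oneTail p m)
    ((m + 2) * ((m + 1) * p ^ m * (1 - p) - p ^ (m + 1))) p := by
  have h := ((hasDerivAt_pow (m + 1) p).const_mul ((m : ℝ) + 2)).mul
    ((hasDerivAt_id p).const_sub 1)
  refine h.congr_deriv ?_
  simp
  ring

theorem hasDerivAt_atMostOneTail (p : ℝ) (m : ℕ) : HasDerivAt (fun p => atMostOneTail p m)
    ((m + 2) * (m + 1) * p ^ m * (1 - p)) p := by
  refine ((hasDerivAt_pow (m + 2) p).add (hasDerivAt_oneTail p m)).congr_deriv ?_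
  push_cast
  ring

theorem hasDerivAt_drift (p : ℝ) (m : ℕ) : HasDerivAt (fun p => drift p m)
    ((m + 2) * p ^ (m + 1) * (1 - p) - p ^ (m + 2) + (m + 2) * (1 - p) ^ (m + 1)) p := by
  have h := ((hasDerivAt_pow (m + 2) p).mul ((hasDerivAt_id p).const_sub 1)).sub
    (hasDerivAt_one_sub_pow p (m + 1))
  refine h.congr_deriv ?_
  simp
  ring

theorem abs_sub_le_of_deriv_le {f f' : ℝ → ℝ} {C : ℝ} (hf : ∀ x, HasDerivAt f (f' x) x)
    (hC : ∀ x ∈ window, |f' x| ≤ C) {p q : ℝ} (hp : p ∈ window) (hq : q ∈ window) :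
    |f p - f q| ≤ C * |p - q| :=
  (convex_Icc _ _).norm_image_sub_le_of_norm_hasDerivWithin_le
    (fun x _ => (hf x).hasDerivWithinAt) hC hq hp

theorem abs_atMostOneTail_sub_le {p q : ℝ} (hp : p ∈ window) (hq : q ∈ window) (m : ℕ) :
    |atMostOneTail p m - atMostOneTail q m| ≤ coeffBound m * |p - q| := by
  refine abs_sub_le_of_deriv_le (fun x => hasDerivAt_atMostOneTail x m) (fun x hx => ?_) hp hq
  have h0 : 0 ≤ x := by linarith [hx.1]
  have h1 : 0 ≤ 1 - x := by linarith [hx.2]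
  have hx' := pow_le_of_mem_window hx m
  rw [abs_of_nonneg (by positivity), coeffBound]
  calc ((m : ℝ) + 2) * (m + 1) * x ^ m * (1 - x)
      ≤ ((m : ℝ) + 2) * (m + 2) * (14 / 25) ^ m * 1 := by gcongr <;> linarith
    _ = _ := by ring

theorem abs_oneTail_sub_le {p q : ℝ} (hp : p ∈ window) (hq : q ∈ window) (m : ℕ) :
    |oneTail p m - oneTail q m| ≤ coeffBound m * |p - q| := by
  refine abs_sub_le_of_deriv_le (fun x => hasDerivAt_oneTail x m) (fun x hx => ?_) hp hq
  have h0 : 0 ≤ x := by linarith [hx.1]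
  have h1 : 0 ≤ 1 - x := by linarith [hx.2]
  have hx' := pow_le_of_mem_window hx m
  have hx0 : 0 ≤ x ^ m := by positivity
  rw [show ((m : ℝ) + 2) * ((m + 1) * x ^ m * (1 - x) - x ^ (m + 1)) =
    (m + 2) * (((m + 1) * (1 - x) - x) * x ^ m) by ring, abs_mul, abs_mul,
    abs_of_nonneg (by positivity : (0 : ℝ) ≤ m + 2), abs_of_nonneg hx0, coeffBound, sq, mul_assoc]
  have hm : (0 : ℝ) ≤ m := by positivity
  gcongr
  rw [abs_le]
  constructor <;> nlinarith [mul_nonneg hm h0, mul_nonneg hm h1]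

theorem abs_drift_sub_le {p q : ℝ} (hp : p ∈ window) (hq : q ∈ window) (m : ℕ) :
    |drift p m - drift q m| ≤ coeffBound m * |p - q| := by
  refine abs_sub_le_of_deriv_le (fun x => hasDerivAt_drift x m) (fun x hx => ?_) hp hq
  have h0 : 27 / 50 ≤ x := hx.1
  have h1 : 0 ≤ 1 - x := by linarith [hx.2]
  have h2 : x ≤ 14 / 25 := hx.2
  have hx' := pow_le_of_mem_window hx m
  have hx0 : 0 ≤ x ^ m := pow_nonneg (by linarith) _
  have hy' := one_sub_pow_le_of_mem_window hx m
  have hy0 : 0 ≤ (1 - x) ^ m := by positivity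
  have hm : (0 : ℝ) ≤ m := by positivity
  have e : ((m : ℝ) + 2) * x ^ (m + 1) * (1 - x) - x ^ (m + 2) + (m + 2) * (1 - x) ^ (m + 1) =
    (x * ((m + 2) * (1 - x) - x)) * x ^ m + ((m + 2) * (1 - x)) * (1 - x) ^ m := by ring
  have ha : |x * ((m + 2) * (1 - x) - x)| ≤ m + 2 := by
    rw [abs_le]
    have hxx : 0 ≤ x := by linarith
    have := mul_nonneg hm h1
    have := mul_nonneg hm hxx
    have := mul_nonneg (mul_nonneg hm h1) hxx
    constructor <;> nlinarith
  have hb : |((m : ℝ) + 2) * (1 - x)| ≤ m + 2 := by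
    rw [abs_of_nonneg (by positivity)]
    nlinarith
  rw [e]
  calc |(x * ((m + 2) * (1 - x) - x)) * x ^ m + ((m + 2) * (1 - x)) * (1 - x) ^ m|
      ≤ |x * ((m + 2) * (1 - x) - x)| * x ^ m + |((m : ℝ) + 2) * (1 - x)| * (1 - x) ^ m := by
        refine (abs_add_le _ _).trans_eq ?_
        rw [abs_mul _ (x ^ m), abs_mul _ ((1 - x) ^ m), abs_of_nonneg hx0, abs_of_nonneg hy0]
    _ ≤ (m + 2) * (14 / 25) ^ m + (m + 2) * (14 / 25) ^ m := by gcongr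
    _ = 2 * (m + 2) * (14 / 25) ^ m := by ring
    _ ≤ coeffBound m := by
      unfold coeffBound
      gcongr
      nlinarith

theorem abs_surplus_increment_sub_le {p q : ℝ} (hp : p ∈ window) (hq : q ∈ window) (m : ℕ) :
    |(surplus p (m + 1) - surplus p m) - (surplus q (m + 1) - surplus q m)| ≤
      coeffBound m * (2 * |surplus p m - surplus q m| + 3 * |p - q|) := by
  have hc0 := atMostOneTail_nonneg (p := p) (by linarith [hp.1]) (by linarith [hp.2]) m
  have hk0 := oneTail_nonneg (p := p) (by linarith [hp.1]) (by linarith [hp.2]) m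
  have hmax : |max (surplus p m) 0 - max (surplus q m) 0| ≤ |surplus p m - surplus q m| :=
    abs_max_sub_max_le_abs _ _ _
  have hmax1 : |max (surplus q m) 0| ≤ 1 := by
    have := abs_le.1 (abs_surplus_le_one hq m)
    rw [abs_of_nonneg (le_max_right _ _)]
    exact max_le this.2 zero_le_one
  have e : (surplus p (m + 1) - surplus p m) - (surplus q (m + 1) - surplus q m) =
      -(atMostOneTail p m * (surplus p m - surplus q m)) +
      -((atMostOneTail p m - atMostOneTail q m) * surplus q m) +
      oneTail p m * (max (surplus p m) 0 - max (surplus q m) 0) +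
      (oneTail p m - oneTail q m) * max (surplus q m) 0 + (drift p m - drift q m) := by
    rw [surplus_succ, surplus_succ]; ring
  rw [e]
  have hB := coeffBound_nonneg m
  calc _ ≤ |atMostOneTail p m| * |surplus p m - surplus q m| +
      |atMostOneTail p m - atMostOneTail q m| * |surplus q m| +
      |oneTail p m| * |max (surplus p m) 0 - max (surplus q m) 0| +
      |oneTail p m - oneTail q m| * |max (surplus q m) 0| + |drift p m - drift q m| := by
        refine (abs_add_le _ _).trans (add_le_add_left ?_ _)
        refine (abs_add_le _ _).trans (add_le_add ?_ (abs_mul _ _).le)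
        refine (abs_add_le _ _).trans (add_le_add ?_ (abs_mul _ _).le)
        refine (abs_add_le _ _).trans_eq ?_
        rw [abs_neg, abs_neg, abs_mul, abs_mul]
    _ ≤ coeffBound m * |surplus p m - surplus q m| + (coeffBound m * |p - q|) * 1 +
      coeffBound m * |surplus p m - surplus q m| + (coeffBound m * |p - q|) * 1 +
      coeffBound m * |p - q| := by
        rw [abs_of_nonneg hc0, abs_of_nonneg hk0]
        gcongr
        · exact atMostOneTail_le_coeffBound hp m
        · exact abs_atMostOneTail_sub_le hp hq m
        · exact abs_surplus_le_one hq m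
        · exact oneTail_le_coeffBound hp m
        · exact abs_oneTail_sub_le hp hq m
        · exact abs_drift_sub_le hp hq m
    _ = _ := by ring

theorem abs_surplus_sub_le {p q : ℝ} (hp : p ∈ window) (hq : q ∈ window) (m : ℕ) :
    |surplus p m - surplus q m| ≤
      3 / 2 * (Real.exp (2 * ∑ i ∈ Finset.range m, coeffBound i) - 1) * |p - q| := by
  induction m with
  | zero => simp [surplus]
  | succ m ih =>
    have h := abs_surplus_increment_sub_le hp hq m
    have hB := coeffBound_nonneg m
    set E := Real.exp (2 * ∑ i ∈ Finset.range m, coeffBound i) with hE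
    have hE' : E * (1 + 2 * coeffBound m) ≤
        Real.exp (2 * ∑ i ∈ Finset.range (m + 1), coeffBound i) := by
      rw [Finset.sum_range_succ, mul_add 2, Real.exp_add, ← hE]
      gcongr
      linarith [Real.add_one_le_exp (2 * coeffBound m)]
    have htri : |surplus p (m + 1) - surplus q (m + 1)| ≤ |surplus p m - surplus q m| +
        |(surplus p (m + 1) - surplus p m) - (surplus q (m + 1) - surplus q m)| := by
      refine le_trans (le_of_eq ?_) (abs_add_le _ _)
      congr 1
      ring
    calc _ ≤ (1 + 2 * coeffBound m) * |surplus p m - surplus q m| +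
          3 * coeffBound m * |p - q| := by linarith
      _ ≤ (1 + 2 * coeffBound m) * (3 / 2 * (E - 1) * |p - q|) + 3 * coeffBound m * |p - q| := by
        gcongr
      _ = 3 / 2 * (E * (1 + 2 * coeffBound m) - 1) * |p - q| := by ring
      _ ≤ _ := by gcongr

/-- A common Lipschitz constant on `window` for all the functions `surplus · m`. -/
noncomputable def lipBound : ℝ := 3 / 2 * (Real.exp (2 * ∑' i, coeffBound i) - 1)

theorem abs_surplus_sub_le_lipBound {p q : ℝ} (hp : p ∈ window) (hq : q ∈ window) (m : ℕ) :
    |surplus p m - surplus q m| ≤ lipBound * |p - q| := by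
  refine (abs_surplus_sub_le hp hq m).trans ?_
  unfold lipBound
  gcongr
  exact summable_coeffBound.sum_le_tsum _ fun i _ => coeffBound_nonneg i

theorem abs_surplus_increment_sub_le_lipBound {p q : ℝ} (hp : p ∈ window) (hq : q ∈ window)
    (m : ℕ) :
    |(surplus p (m + 1) - surplus p m) - (surplus q (m + 1) - surplus q m)| ≤
      coeffBound m * (2 * lipBound + 3) * |p - q| := by
  refine (abs_surplus_increment_sub_le hp hq m).trans ?_
  have := abs_surplus_sub_le_lipBound hp hq m
  rw [mul_assoc]
  gcongr
  · exact coeffBound_nonneg m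
  · linarith

theorem hasDerivAt_of_tendsto_of_summable_lipschitz {f : ℕ → ℝ → ℝ} {g : ℝ → ℝ} {f' L : ℕ → ℝ}
    {U : Set ℝ} {r : ℝ} (hU : U ∈ nhds r) (hL : Summable L) (hL0 : ∀ m, 0 ≤ L m)
    (hf : ∀ m, HasDerivAt (f m) (f' m) r)
    (hlip : ∀ m, ∀ p ∈ U, |(f (m + 1) p - f m p) - (f (m + 1) r - f m r)| ≤ L m * |p - r|)
    (hg : ∀ p ∈ U, Filter.Tendsto (fun m => f m p) Filter.atTop (nhds (g p))) :
    ∃ d, Filter.Tendsto f' Filter.atTop (nhds d) ∧ HasDerivAt g d r := by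
  have hcauchy : CauchySeq f' := cauchySeq_of_dist_le_of_summable L (fun m => by
    rw [dist_comm, Real.dist_eq]
    exact ((hf (m + 1)).sub (hf m)).le_of_lip' (hL0 m)
      (Filter.mem_of_superset hU fun p hp => hlip m p hp)) hL
  obtain ⟨d, hd⟩ := cauchySeq_tendsto_of_complete hcauchy
  refine ⟨d, hd, hasDerivAt_iff_tendsto_slope.2 ?_⟩
  have hunif : TendstoUniformlyOnFilter (fun m => slope (f m) r) (slope g r) Filter.atTop
      (nhdsWithin r {r}ᶜ) := by
    rw [Metric.tendstoUniformlyOnFilter_iff]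
    intro ε hε
    have htail : ∀ᶠ m in Filter.atTop, ∑' k, L (k + m) < ε :=
      (tendsto_sum_nat_add L).eventually_lt_const hε
    have hmem : ∀ᶠ p in nhdsWithin r {r}ᶜ, p ∈ U ∧ p ≠ r :=
      (Filter.Eventually.filter_mono nhdsWithin_le_nhds hU).and self_mem_nhdsWithin
    filter_upwards [htail.prod_mk hmem] with ⟨m, p⟩ ⟨hm, hpU, hpr⟩
    have hpos : 0 < |p - r| := abs_pos.2 (sub_ne_zero.2 hpr)
    have hlim : Filter.Tendsto (fun m => slope (f m) r p) Filter.atTop (nhds (slope g r p)) := by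
      simp only [slope_def_field]
      exact ((hg p hpU).sub (hg r (mem_of_mem_nhds hU))).div_const _
    have hdist := dist_le_tsum_of_dist_le_of_tendsto L (fun k => ?_) hL hlim m
    · rw [dist_comm]
      refine hdist.trans_lt ?_
      simpa only [add_comm m] using hm
    · rw [dist_comm, Real.dist_eq, slope_def_field, slope_def_field, ← sub_div, abs_div,
        div_le_iff₀ hpos]
      refine le_trans (le_of_eq ?_) (hlip k p hpU)
      congr 1
      simp only [Nat.succ_eq_add_one]
      ring
  exact hunif.tendsto_of_eventually_tendsto
    (Filter.Eventually.of_forall fun m => hasDerivAt_iff_tendsto_slope.1 (hf m)) hd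

theorem pos_of_tendsto_of_one_sub_mul_le {x c : ℕ → ℝ} {d : ℝ} (hc : Summable c)
    (hc0 : ∀ m, 0 ≤ c m) (hc1 : ∀ m, c m < 1) (hx0 : 0 < x 0)
    (hx : ∀ m, (1 - c m) * x m ≤ x (m + 1)) (hd : Filter.Tendsto x Filter.atTop (nhds d)) :
    0 < d := by
  have hpos : ∀ m, 0 < x m := fun m => by
    induction m with
    | zero => exact hx0
    | succ m ih => exact (mul_pos (sub_pos.2 (hc1 m)) ih).trans_le (hx m)
  obtain ⟨N, hN⟩ := ((tendsto_sum_nat_add c).eventually_lt_const one_half_pos).exists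
  have hbound : ∀ k, (1 - ∑ i ∈ Finset.range k, c (i + N)) * x N ≤ x (k + N) := fun k => by
    induction k with
    | zero => simp
    | succ k ih =>
      have h1 := mul_le_mul_of_nonneg_left ih (sub_nonneg.2 (hc1 (k + N)).le)
      have h2 := hx (k + N)
      have h3 : 0 ≤ c (k + N) * (∑ i ∈ Finset.range k, c (i + N)) * x N :=
        mul_nonneg (mul_nonneg (hc0 _) (Finset.sum_nonneg fun i _ => hc0 _)) (hpos N).le
      rw [Finset.sum_range_succ, show k + 1 + N = k + N + 1 by lia]
      linarith
  have hge : 1 / 2 * x N ≤ d := by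
    refine ge_of_tendsto' (hd.comp (Filter.tendsto_add_atTop_nat N)) fun k => ?_
    refine le_trans ?_ (hbound k)
    have := ((summable_nat_add_iff N).2 hc).sum_le_tsum (Finset.range k) fun i _ => hc0 _
    exact mul_le_mul_of_nonneg_right (by linarith) (hpos N).le
  linarith [hpos N]

theorem hasDerivAt_surplus_one (p : ℝ) :
    HasDerivAt (fun p => surplus p 1) (2 * p * (1 - p) - p ^ 2 + 2 * (1 - p)) p := by
  have h := hasDerivAt_drift p 0
  have e : (fun p => surplus p 1) = fun p => drift p 0 := by
    ext p; simp [surplus]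
  rw [e]
  refine h.congr_deriv ?_
  push_cast
  ring

theorem hasDerivAt_surplus_succ {r D : ℝ} {m : ℕ} (hD : HasDerivAt (fun p => surplus p m) D r)
    (hneg : surplus r m < 0) :
    HasDerivAt (fun p => surplus p (m + 1))
      ((1 - atMostOneTail r m) * D - (m + 2) * (m + 1) * r ^ m * (1 - r) * surplus r m +
        ((m + 2) * r ^ (m + 1) * (1 - r) - r ^ (m + 2) + (m + 2) * (1 - r) ^ (m + 1))) r := by
  have h := (((hasDerivAt_atMostOneTail r m).const_sub 1).mul hD).add (hasDerivAt_drift r m)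
  refine (h.congr_deriv (by ring)).congr_of_eventuallyEq ?_
  filter_upwards [hD.continuousAt.eventually_lt_const hneg] with p hp
  exact surplus_succ_of_nonpos hp.le

theorem exists_deriv_seq {r : ℝ} (hr : r ∈ window) (hneg : ∀ m, surplus r (m + 1) < 0) :
    ∃ D : ℕ → ℝ, (∀ m, HasDerivAt (fun p => surplus p (m + 1)) (D m) r) ∧ 0 < D 0 ∧
      ∀ m, (1 - atMostOneTail r (m + 1)) * D m ≤ D (m + 1) := by
  have hl : 27 / 50 ≤ r := hr.1
  have hu : r ≤ 14 / 25 := hr.2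
  have hdiff : ∀ m, DifferentiableAt ℝ (fun p => surplus p (m + 1)) r := fun m => by
    induction m with
    | zero => exact (hasDerivAt_surplus_one r).differentiableAt
    | succ m ih => exact (hasDerivAt_surplus_succ ih.hasDerivAt (hneg m)).differentiableAt
  refine ⟨fun m => deriv (fun p => surplus p (m + 1)) r, fun m => (hdiff m).hasDerivAt, ?_,
    fun m => ?_⟩
  · simp only [zero_add, (hasDerivAt_surplus_one r).deriv]
    nlinarith
  · beta_reduce
    rw [(hasDerivAt_surplus_succ (hdiff m).hasDerivAt (hneg m)).deriv]
    have h0 : 0 ≤ r := by linarith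
    have h1 : 0 ≤ 1 - r := by linarith
    have ha : 0 ≤ ((m + 1 : ℕ) + 2 : ℝ) * ((m + 1 : ℕ) + 1) * r ^ (m + 1) * (1 - r) *
        -surplus r (m + 1) :=
      mul_nonneg (by positivity) (neg_nonneg.2 (hneg m).le)
    have hb : 0 ≤ ((m + 1 : ℕ) + 2 : ℝ) * (1 - r) ^ (m + 1 + 1) := by positivity
    have hc : 0 ≤ r ^ (m + 1 + 1) * (((m + 1 : ℕ) + 2 : ℝ) * (1 - r) - r) := by
      refine mul_nonneg (by positivity) ?_
      have : 0 ≤ (m : ℝ) * (1 - r) := by positivity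
      push_cast
      linarith
    have e : r ^ (m + 1 + 1) * (((m + 1 : ℕ) + 2 : ℝ) * (1 - r) - r) =
        ((m + 1 : ℕ) + 2 : ℝ) * r ^ (m + 1 + 1) * (1 - r) - r ^ (m + 1 + 2) := by ring
    rw [e] at hc
    linarith

theorem tendsto_surplus {S : ℝ → ℝ} (hS : ∀ p : ℝ, 1 / 2 ≤ p → p ≤ 1 →
      Filter.Tendsto (fun n : ℕ => s p n) Filter.atTop (nhds (S p))) {p : ℝ} (hp : p ∈ window) :
    Filter.Tendsto (fun m => surplus p m) Filter.atTop (nhds (S p)) := by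
  have h := (hS p (by linarith [hp.1]) (by linarith [hp.2])).comp (Filter.tendsto_add_atTop_nat 1)
  exact h.congr fun m => s_succ_eq_surplus hp m

theorem surplus_succ_lt_of_tendsto {p a : ℝ} (hp : p ∈ window)
    (h : Filter.Tendsto (fun m => surplus p m) Filter.atTop (nhds a)) (m : ℕ) :
    surplus p (m + 1) < a :=
  (surplus_lt_succ hp m).trans_le
    ((surplus_strictMono hp).monotone.ge_of_tendsto
      (h.comp (Filter.tendsto_add_atTop_nat 1)) (m + 1))

theorem continuousOn_of_tendsto_surplus {S : ℝ → ℝ}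
    (h : ∀ p ∈ window, Filter.Tendsto (fun m => surplus p m) Filter.atTop (nhds (S p))) :
    ContinuousOn S window := by
  refine (LipschitzOnWith.of_dist_le_mul (K := lipBound.toNNReal) fun p hp q hq => ?_).continuousOn
  refine le_of_tendsto' ((h p hp).dist (h q hq)) fun m => ?_
  refine (abs_surplus_sub_le_lipBound hp hq m).trans ?_
  rw [Real.dist_eq]
  gcongr
  exact Real.le_coe_toNNReal _

theorem exists_zero_of_tendsto_surplus {S : ℝ → ℝ}
    (h : ∀ p ∈ window, Filter.Tendsto (fun m => surplus p m) Filter.atTop (nhds (S p))) :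
    ∃ r ∈ Set.Ioo (27 / 50 : ℝ) (14 / 25), S r = 0 := by
  have hle : (27 / 50 : ℝ) ≤ 14 / 25 := by norm_num
  have hl : S (27 / 50) < 0 := by
    have hlim := (h _ (Set.left_mem_Icc.2 hle)).comp (Filter.tendsto_add_atTop_nat 6)
    have : S (27 / 50) ≤ -(1 / 100) := le_of_tendsto' hlim fun m => by
      refine (surplus_left_le_barrier m).trans (neg_le_neg ?_)
      have : (0 : ℝ) ≤ (21 / 1000 * (m + 7) + 611 / 1000) * (27 / 50) ^ (m + 7) := by positivity
      linarith
    linarith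
  have hr : 0 < S (14 / 25) := surplus_right_pos.trans
    (surplus_succ_lt_of_tendsto (Set.right_mem_Icc.2 hle) (h _ (Set.right_mem_Icc.2 hle)) 4)
  exact intermediate_value_Ioo hle (continuousOn_of_tendsto_surplus h) ⟨hl, hr⟩

end CoinGame

open CoinGame in
theorem coin_game_s_differentiable_at_p0 (S : ℝ → ℝ)
    (hS : ∀ p : ℝ, 1 / 2 ≤ p → p ≤ 1 →
      Filter.Tendsto (fun n : ℕ => s p n) Filter.atTop (nhds (S p)))
    (p0 : ℝ) (hp0l : 1 / 2 ≤ p0) (hp0u : p0 < 1) (hp0z : S p0 = 0)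
    (hp0uniq : ∀ q : ℝ, 1 / 2 ≤ q → q < 1 → S q = 0 → q = p0) :
    ∃ d : ℝ, 0 < d ∧ HasDerivAt S d p0 := by
  have hlim : ∀ p ∈ window, Filter.Tendsto (fun m => surplus p m) Filter.atTop (nhds (S p)) :=
    fun p hp => tendsto_surplus hS hp
  obtain ⟨r, hr, hr0⟩ := exists_zero_of_tendsto_surplus hlim
  obtain rfl := hp0uniq r (by linarith [hr.1]) (by linarith [hr.2]) hr0
  have hrw : r ∈ window := Set.Ioo_subset_Icc_self hr
  have hneg : ∀ m, surplus r (m + 1) < 0 := fun m =>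
    (surplus_succ_lt_of_tendsto hrw (hlim r hrw) m).trans_eq hr0
  obtain ⟨D, hD, hD0, hDstep⟩ := exists_deriv_seq hrw hneg
  have hsummable := (summable_nat_add_iff 1).2 summable_coeffBound
  have hlip : 0 ≤ lipBound := by
    have : 0 ≤ ∑' i, coeffBound i := tsum_nonneg coeffBound_nonneg
    have := Real.one_le_exp (mul_nonneg zero_le_two this)
    unfold lipBound
    linarith
  obtain ⟨d, hd, hder⟩ := hasDerivAt_of_tendsto_of_summable_lipschitz (Icc_mem_nhds hr.1 hr.2)
    (hsummable.mul_right (2 * lipBound + 3))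
    (fun m => mul_nonneg (coeffBound_nonneg _) (by linarith)) hD
    (fun m p hp => abs_surplus_increment_sub_le_lipBound hp hrw (m + 1))
    (fun p hp => (hlim p hp).comp (Filter.tendsto_add_atTop_nat 1))
  have hc0 : ∀ m, 0 ≤ atMostOneTail r (m + 1) := fun m =>
    atMostOneTail_nonneg (by linarith [hr.1]) (by linarith [hr.2]) _
  exact ⟨d, pos_of_tendsto_of_one_sub_mul_le
    (Summable.of_nonneg_of_le hc0 (fun m => atMostOneTail_le_coeffBound hrw _) hsummable) hc0
    (fun m => atMostOneTail_lt_one (by linarith [hr.1]) (by linarith [hr.2]) _) hD0 hDstep hd, hder⟩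
end

section
/- Let s'(p_0) denote the derivative of s at p_0 (which exists and is positive). For every ε > 0 there exists δ > 0 such that for all p ∈ (p_0, p_0 + δ), the integer n(p) exists and satisfies (log(p − p_0) + log(s'(p_0)))/log(p_0) − 1 − ε < n(p) < (log(p − p_0) + log(s'(p_0)))/log(p_0) + ε. -/
/-- `IsNp p m` asserts that `m` is the smallest integer `n ≥ 2` with `s p n ≥ 0`. -/
def IsNp (p : ℝ) (m : ℕ) : Prop :=
  2 ≤ m ∧ 0 ≤ s p m ∧ ∀ k : ℕ, 2 ≤ k → 0 ≤ s p k → m ≤ k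

open Filter Topology

theorem s_one (p : ℝ) : s p 1 = 0 := by
  have h : ∀ x ∈ (Finset.Icc 1 0).attach, (x : ℕ) ∉ Finset.Icc 1 0 := by simp
  simp only [s, v]
  rw [Finset.sum_eq_zero fun x hx => absurd x.2 (h x hx)]
  simp

theorem sum_binomial_Icc (p : ℝ) (n : ℕ) :
    ∑ j ∈ Finset.Icc 1 n, (((n + 1).choose j : ℕ) : ℝ) * p ^ j * (1 - p) ^ (n + 1 - j) =
      1 - p ^ (n + 1) - (1 - p) ^ (n + 1) := by
  have h := add_pow p (1 - p) (n + 1)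
  rw [Finset.sum_range_succ, Finset.sum_range_succ', add_sub_cancel, one_pow] at h
  have h2 : ∑ j ∈ Finset.Icc 1 n, (((n + 1).choose j : ℕ) : ℝ) * p ^ j * (1 - p) ^ (n + 1 - j) =
      ∑ j ∈ Finset.range n,
        p ^ (j + 1) * (1 - p) ^ (n + 1 - (j + 1)) * (((n + 1).choose (j + 1) : ℕ) : ℝ) := by
    rw [← Finset.Ico_add_one_right_eq_Icc, Finset.sum_Ico_eq_sum_range]
    refine Finset.sum_congr (by simp) fun j _ => ?_
    rw [add_comm 1 j]
    ring
  rw [h2]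
  simp at h ⊢
  linarith

/-- The recursion for `s`, with the value `W j` of the best move after `j` heads. -/
theorem s_succ_eq (p : ℝ) (n : ℕ) : ∃ W : ℕ → ℝ,
    s p (n + 1) = p ^ (n + 1) * (1 - p) - (1 - p) ^ (n + 1) + (1 - p) ^ (n + 1) * s p n +
      ∑ j ∈ Finset.Icc 1 n,
        (((n + 1).choose j : ℕ) : ℝ) * p ^ j * (1 - p) ^ (n + 1 - j) * W j ∧
    ∀ j ∈ Finset.Icc 1 n, s p n ≤ W j ∧ ∃ k, n + 1 - j ≤ k ∧ k ≤ n ∧ W j = s p k := by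
  set F : {j // j ∈ Finset.Icc 1 n} → ℝ := fun j =>
    (Finset.Icc 1 j.1).attach.sup'
      (Finset.attach_nonempty_iff.mpr (Finset.nonempty_Icc.mpr (Finset.mem_Icc.mp j.2).1))
      (fun i => v p (n + 1 - i.1) + (i.1 : ℝ)) with hF
  have hv : ∀ j i : ℕ, j ≤ n → i ≤ j → v p (n + 1 - i) + (i : ℝ) = s p (n + 1 - i) + (n + p) := by
    intro j i hj hi
    simp only [s]
    rw [Nat.cast_sub (by omega)]
    push_cast
    ring
  refine ⟨fun j => (if h : j ∈ Finset.Icc 1 n then F ⟨j, h⟩ else 0) - (n + p), ?_, ?_⟩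
  · have h1 : v p (n + 1) = ((n : ℝ) + 1) * p ^ (n + 1) + v p n * (1 - p) ^ (n + 1) +
        ∑ j ∈ Finset.Icc 1 n, (((n + 1).choose j : ℕ) : ℝ) * p ^ j * (1 - p) ^ (n + 1 - j) *
          (if h : j ∈ Finset.Icc 1 n then F ⟨j, h⟩ else 0) := by
      rw [v, ← Finset.sum_attach (Finset.Icc 1 n)]
      congr 1
      refine Finset.sum_congr rfl fun j _ => ?_
      rw [dif_pos j.2]
    simp only [mul_sub, Finset.sum_sub_distrib, ← Finset.sum_mul, sum_binomial_Icc]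
    simp only [s, h1]
    push_cast
    ring
  · intro j hj
    have hj' := Finset.mem_Icc.mp hj
    simp only [dif_pos hj]
    constructor
    · have h1 : v p (n + 1 - 1) + ((1 : ℕ) : ℝ) ≤ F ⟨j, hj⟩ :=
        Finset.le_sup' (s := (Finset.Icc 1 j).attach)
          (fun i : {i // i ∈ Finset.Icc 1 j} => v p (n + 1 - i.1) + (i.1 : ℝ))
          (Finset.mem_attach _ ⟨1, Finset.mem_Icc.mpr ⟨le_rfl, hj'.1⟩⟩)
      rw [hv j 1 hj'.2 hj'.1, Nat.add_sub_cancel] at h1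
      linarith
    · obtain ⟨i, -, hi⟩ := Finset.exists_mem_eq_sup' (Finset.attach_nonempty_iff.mpr
        (Finset.nonempty_Icc.mpr hj'.1)) (fun i : {i // i ∈ Finset.Icc 1 j} =>
          v p (n + 1 - i.1) + (i.1 : ℝ))
      have hi' := Finset.mem_Icc.mp i.2
      refine ⟨n + 1 - i.1, by omega, by omega, ?_⟩
      rw [hF]
      simp only [hi]
      rw [hv j i hj'.2 hi'.2]
      ring

theorem binomial_term_nonneg {p : ℝ} (h0 : 0 ≤ p) (h1 : p ≤ 1) (n j : ℕ) :
    0 ≤ ((n.choose j : ℕ) : ℝ) * p ^ j * (1 - p) ^ (n - j) := by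
  have : 0 ≤ 1 - p := by linarith
  positivity

theorem le_s_succ {p : ℝ} (h0 : 0 ≤ p) (h1 : p ≤ 1) (n : ℕ) :
    p ^ (n + 1) * (1 - p) - (1 - p) ^ (n + 1) + (1 - p ^ (n + 1)) * s p n ≤ s p (n + 1) := by
  obtain ⟨W, hs, hW⟩ := s_succ_eq p n
  have h := Finset.sum_le_sum fun j hj =>
    mul_le_mul_of_nonneg_left (hW j hj).1 (binomial_term_nonneg h0 h1 (n + 1) j)
  rw [← Finset.sum_mul, sum_binomial_Icc] at h
  rw [hs]
  linarith

theorem s_succ_le {p M : ℝ} (h0 : 0 ≤ p) (h1 : p ≤ 1) {n : ℕ} (hn : 1 ≤ n)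
    (hM : ∀ k, 1 ≤ k → k ≤ n → s p k ≤ M) :
    s p (n + 1) ≤ p ^ (n + 1) * (1 - p) - (1 - p) ^ (n + 1) + (1 - p ^ (n + 1)) * M := by
  obtain ⟨W, hs, hW⟩ := s_succ_eq p n
  have hWM : ∀ j ∈ Finset.Icc 1 n, W j ≤ M := by
    intro j hj
    obtain ⟨-, k, hk1, hk2, hk⟩ := hW j hj
    rw [Finset.mem_Icc] at hj
    exact hk ▸ hM k (by omega) hk2
  have h := Finset.sum_le_sum fun j hj =>
    mul_le_mul_of_nonneg_left (hWM j hj) (binomial_term_nonneg h0 h1 (n + 1) j)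
  rw [← Finset.sum_mul, sum_binomial_Icc] at h
  have hq : (1 - p) ^ (n + 1) * s p n ≤ (1 - p) ^ (n + 1) * M :=
    mul_le_mul_of_nonneg_left (hM n hn le_rfl) (pow_nonneg (by linarith) _)
  rw [hs]
  linarith

/-- After `n` heads out of `n + 1` the value is at most `s p 1 = 0`; otherwise it is at most the
common bound of the later values. -/
theorem s_succ_le_of_nonpos {p M : ℝ} (h0 : 0 ≤ p) (h1 : p ≤ 1) {n : ℕ} (hn : 2 ≤ n)
    (hM0 : M ≤ 0) (hM : ∀ k, 2 ≤ k → k ≤ n → s p k ≤ M) :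
    s p (n + 1) ≤ p ^ (n + 1) * (1 - p) - (1 - p) ^ (n + 1) +
      (1 - p ^ (n + 1) - (n + 1) * p ^ n * (1 - p)) * M := by
  obtain ⟨W, hs, hW⟩ := s_succ_eq p n
  have hWM : ∀ j ∈ Finset.Icc 1 n, W j ≤ M - (if j = n then M else 0) := by
    intro j hj
    obtain ⟨-, k, hk1, hk2, hk⟩ := hW j hj
    rw [Finset.mem_Icc] at hj
    rw [hk]
    rcases (show k = 1 ∨ 2 ≤ k by omega) with rfl | hk'
    · rw [if_pos (by omega), s_one, sub_self]
    · have := hM k hk' hk2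
      split_ifs <;> linarith
  have h := Finset.sum_le_sum fun j hj =>
    mul_le_mul_of_nonneg_left (hWM j hj) (binomial_term_nonneg h0 h1 (n + 1) j)
  simp only [mul_sub, Finset.sum_sub_distrib] at h
  rw [← Finset.sum_mul, sum_binomial_Icc] at h
  have hmem : n ∈ Finset.Icc 1 n := Finset.mem_Icc.mpr ⟨by omega, le_rfl⟩
  simp only [mul_ite, mul_zero, Finset.sum_ite_eq', hmem, if_true, Nat.choose_succ_self_right,
    Nat.add_sub_cancel_left, pow_one] at h
  push_cast at h
  have hq : (1 - p) ^ (n + 1) * s p n ≤ (1 - p) ^ (n + 1) * M :=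
    mul_le_mul_of_nonneg_left (hM n hn le_rfl) (pow_nonneg (by linarith) _)
  rw [hs]
  linarith

theorem continuous_v (n : ℕ) : Continuous fun p => v p n := by
  induction n using Nat.strong_induction_on with
  | _ n ih =>
    cases n with
    | zero => simpa [v] using continuous_const
    | succ n =>
      simp only [v]
      refine ((by fun_prop : Continuous fun p : ℝ => ((n : ℝ) + 1) * p ^ (n + 1)).add
        ((ih n (by omega)).mul (by fun_prop))).add (continuous_finsetSum _ fun j _ => ?_)
      refine Continuous.mul (by fun_prop) (Continuous.finset_sup'_apply _ fun i _ => ?_)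
      have hi := Finset.mem_Icc.mp i.2
      exact (ih _ (by omega)).add continuous_const

theorem continuous_s (n : ℕ) : Continuous fun p => s p n := by
  have := continuous_v n
  unfold s
  fun_prop

/-- If the limit is `0`, then `s p n < 0` for all `n ≥ 2`: after a first nonnegative term the
sequence would stay positive and be bounded away from `0`. -/
theorem s_neg_of_tendsto_zero {p : ℝ} (hp : 1 / 2 ≤ p) (hp1 : p < 1)
    (hlim : Tendsto (fun n => s p n) atTop (𝓝 0)) {n : ℕ} (hn : 2 ≤ n) : s p n < 0 := by
  by_contra! hns
  have hex : ∃ m, 2 ≤ m ∧ 0 ≤ s p m := ⟨n, hn, hns⟩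
  classical
  obtain ⟨hm2, hm⟩ := Nat.find_spec hex
  have hmin : ∀ k, k < Nat.find hex → 2 ≤ k → s p k < 0 := by
    intro k hk hk2
    by_contra! h
    exact Nat.find_min hex hk ⟨hk2, h⟩
  generalize Nat.find hex = m at hm2 hm hmin
  have hp0 : 0 < p := by linarith
  have hq0 : 0 < 1 - p := by linarith
  have hcross : (1 - p) ^ m ≤ p ^ m * (1 - p) := by
    obtain ⟨k, rfl⟩ : ∃ k, m = k + 1 := ⟨m - 1, by omega⟩
    have := s_succ_le (M := 0) hp0.le hp1.le (n := k) (by omega) fun i hi1 hik => by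
      rcases (show i = 1 ∨ 2 ≤ i by omega) with rfl | hi2
      · exact (s_one p).le
      · exact (hmin i (by omega) hi2).le
    linarith
  have hpq : 1 - p < p := by
    rcases eq_or_lt_of_le hp with h | h
    · subst h
      norm_num at hcross
    · linarith
  have hgain : ∀ k, m < k → (1 - p) ^ k < p ^ k * (1 - p) := by
    intro k hk
    induction k, hk using Nat.le_induction with
    | base =>
      have : 0 < p ^ m * (1 - p) := by positivity
      rw [pow_succ, pow_succ]
      nlinarith
    | succ k _ ih =>
      have : 0 < p ^ k * (1 - p) := by positivity
      rw [pow_succ, pow_succ p]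
      nlinarith
  have hpos : ∀ k, m < k → 0 < s p k := by
    intro k hk
    induction k, hk using Nat.le_induction with
    | base =>
      have h1 := le_s_succ hp0.le hp1.le m
      have h2 := hgain (m + 1) (by omega)
      have h3 : p ^ (m + 1) ≤ 1 := pow_le_one₀ hp0.le hp1.le
      nlinarith [mul_nonneg (sub_nonneg.mpr h3) hm]
    | succ k hk ih =>
      have h1 := le_s_succ hp0.le hp1.le k
      have h2 := hgain (k + 1) (by omega)
      have h3 : p ^ (k + 1) ≤ 1 := pow_le_one₀ hp0.le hp1.le
      nlinarith [mul_nonneg (sub_nonneg.mpr h3) ih.le]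
  have hratio : Tendsto (fun k : ℕ => ((1 - p) / p) ^ k) atTop (𝓝 0) :=
    tendsto_pow_atTop_nhds_zero_of_lt_one (by positivity) ((div_lt_one hp0).mpr hpq)
  have hev := (hlim.eventually (gt_mem_nhds (half_pos hq0))).and
    (((tendsto_add_atTop_iff_nat 1).mpr hratio).eventually (gt_mem_nhds (half_pos hq0)))
  obtain ⟨N, hN⟩ := eventually_atTop.mp hev
  have hmono : ∀ k, max N (m + 1) ≤ k → s p (max N (m + 1)) ≤ s p k := by
    intro k hk
    induction k, hk using Nat.le_induction with
    | base => exact le_rfl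
    | succ k hk ih =>
      obtain ⟨h1, h2⟩ := hN k (le_trans (le_max_left _ _) hk)
      have h3 := le_s_succ hp0.le hp1.le k
      have h4 : 0 < p ^ (k + 1) := by positivity
      rw [div_pow, div_lt_iff₀ h4] at h2
      nlinarith
  have h1 := ge_of_tendsto hlim (eventually_atTop.mpr ⟨_, hmono⟩)
  have h2 := hpos (max N (m + 1)) (by have := le_max_right N (m + 1); omega)
  linarith

theorem s_half_le {n : ℕ} (hn : 2 ≤ n) :
    s (1 / 2) n ≤ -(1 / 18) * (1 + (n + 3) * (1 / 2) ^ n) := by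
  induction n using Nat.strong_induction_on with
  | _ n ih =>
    rcases (show n = 2 ∨ 3 ≤ n by omega) with rfl | hn3
    · have := s_succ_le (p := 1 / 2) (M := 0) (by norm_num) (by norm_num) (n := 1) le_rfl
        fun k hk1 hk2 => by
          obtain rfl : k = 1 := by omega
          exact (s_one _).le
      norm_num at this ⊢
      linarith
    · obtain ⟨m, rfl⟩ : ∃ m, n = m + 1 := ⟨n - 1, by omega⟩
      have hanti : ∀ k, 2 ≤ k → k ≤ m →
          ((m : ℝ) + 3) * (1 / 2) ^ m ≤ (k + 3) * (1 / 2) ^ k := by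
        intro k _ hkm
        refine antitone_nat_of_succ_le (f := fun i : ℕ => ((i : ℝ) + 3) * (1 / 2) ^ i)
          (fun i => ?_) hkm
        have : (0 : ℝ) < (1 / 2) ^ i := by positivity
        push_cast
        rw [pow_succ]
        nlinarith
      have hb : ((m : ℝ) + 2) * (m + 3) ≤ 4 * 2 ^ (m + 1) := by
        clear ih hanti hn
        have hm : 2 ≤ m := by omega
        clear hn3
        induction m, hm using Nat.le_induction with
        | base => norm_num
        | succ m hm ihm =>
          have : (2 : ℝ) ≤ m := by exact_mod_cast hm
          push_cast
          rw [pow_succ]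
          nlinarith
      have := s_succ_le_of_nonpos (p := 1 / 2)
        (M := -(1 / 18) * (1 + (m + 3) * (1 / 2) ^ m)) (by norm_num) (by norm_num) (n := m)
        (by omega) (by
          have : (0 : ℝ) ≤ (m + 3) * (1 / 2) ^ m := by positivity
          linarith) fun k hk2 hkm => by
          have h1 := ih k (by omega) hk2
          have h2 := hanti k hk2 hkm
          linarith
      refine this.trans ?_
      have hx : (0 : ℝ) < (1 / 2) ^ m := by positivity
      have hxb : ((m : ℝ) + 2) * (m + 3) * (1 / 2) ^ m ≤ 8 := by
        have h1 := mul_le_mul_of_nonneg_right hb hx.le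
        have h2 : (2 : ℝ) ^ (m + 1) * (1 / 2) ^ m = 2 := by
          rw [pow_succ, mul_right_comm, ← mul_pow]
          norm_num
        linarith
      rw [show (1 : ℝ) - 1 / 2 = 1 / 2 by norm_num, pow_succ]
      push_cast
      nlinarith [mul_le_mul_of_nonneg_left hxb hx.le]

theorem half_lt_of_tendsto_zero {p : ℝ} (hp : 1 / 2 ≤ p)
    (hlim : Tendsto (fun n => s p n) atTop (𝓝 0)) : 1 / 2 < p := by
  refine lt_of_le_of_ne hp ?_
  rintro rfl
  have := le_of_tendsto hlim (b := -(1 / 18)) (eventually_atTop.mpr ⟨2, fun n hn => ?_⟩)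
  · norm_num at this
  · have h1 := s_half_le hn
    have h2 : (0 : ℝ) ≤ (n + 3) * (1 / 2) ^ n := by positivity
    linarith

/-- As long as `s p k ≤ 0` for `2 ≤ k ≤ K`, the whole sequence stays below `p ^ (K + 1)`. -/
theorem s_le_pow {p : ℝ} (h0 : 0 ≤ p) (h1 : p ≤ 1) {K : ℕ} (hK : 1 ≤ K)
    (hneg : ∀ k, 2 ≤ k → k ≤ K → s p k ≤ 0) {n : ℕ} (hn : K ≤ n) :
    ∀ k, 1 ≤ k → k ≤ n → s p k ≤ p ^ (K + 1) - p ^ (n + 1) := by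
  induction n, hn using Nat.le_induction with
  | base =>
    intro k hk1 hk
    rw [sub_self]
    rcases (show k = 1 ∨ 2 ≤ k by omega) with rfl | hk2
    · exact (s_one p).le
    · exact hneg k hk2 hk
  | succ n hn ih =>
    have hle : p ^ (n + 2) ≤ p ^ (n + 1) := pow_le_pow_of_le_one h0 h1 (by omega)
    intro k hk1 hk
    rcases Nat.lt_or_ge n k with hk' | hk'
    · obtain rfl : k = n + 1 := by omega
      have h2 := s_succ_le h0 h1 (by omega) ih
      have h3 : p ^ (n + 1) ≤ p ^ (K + 1) := pow_le_pow_of_le_one h0 h1 (by omega)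
      have h4 : 0 ≤ p ^ (n + 1) := by positivity
      have h5 : 0 ≤ (1 - p) ^ (n + 1) := pow_nonneg (by linarith) _
      have h6 := mul_nonneg h4 (sub_nonneg.mpr h3)
      rw [pow_succ p (n + 1)]
      nlinarith
    · exact (ih k hk1 hk').trans (by linarith)

/-- Near a zero `p0` of the limit, `s p n` eventually dominates all its predecessors, uniformly
in `p`. -/
theorem eventually_s_le_s {p0 : ℝ} (hp0 : 1 / 2 < p0) (hp1 : p0 < 1)
    (hlim : Tendsto (fun n => s p0 n) atTop (𝓝 0)) :
    ∃ K : ℕ, 2 ≤ K ∧ ∀ᶠ p in 𝓝 p0, ∀ n, K ≤ n → ∀ k, 2 ≤ k → k ≤ n → s p k ≤ s p n := by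
  obtain ⟨r, hr, hrp⟩ := exists_between hp0
  obtain ⟨R, hpR, hR⟩ := exists_between hp1
  have hr0 : 0 < r := by linarith
  have hR2 : 0 < (1 - R) / 2 := by linarith
  have hneg : ∀ n, 2 ≤ n → s p0 n < 0 := fun n hn =>
    s_neg_of_tendsto_zero hp0.le hp1 hlim hn
  have hev1 : ∀ᶠ n : ℕ in atTop, R ^ n < (1 - R) / 2 :=
    (tendsto_pow_atTop_nhds_zero_of_lt_one (by linarith) hR).eventually (gt_mem_nhds hR2)
  have hev2 : ∀ᶠ n : ℕ in atTop, ((1 - r) / r) ^ n < (1 - R) / 2 :=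
    (tendsto_pow_atTop_nhds_zero_of_lt_one (div_nonneg (by linarith) hr0.le)
      ((div_lt_one hr0).mpr (by linarith))).eventually (gt_mem_nhds hR2)
  obtain ⟨L, hL2, hL⟩ : ∃ L : ℕ, 2 ≤ L ∧ ∀ n, L ≤ n →
      R ^ n < (1 - R) / 2 ∧ ((1 - r) / r) ^ n < (1 - R) / 2 := by
    obtain ⟨L, hL⟩ := eventually_atTop.mp (hev1.and hev2)
    exact ⟨max L 2, le_max_right _ _, fun n hn => hL n (le_trans (le_max_left _ _) hn)⟩
  obtain ⟨K, hKL, hK⟩ : ∃ K : ℕ, L ≤ K ∧ ∀ k ∈ Finset.Icc 2 L, s p0 k < s p0 K := by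
    have h : ∀ᶠ n in atTop, ∀ k ∈ Finset.Icc 2 L, s p0 k < s p0 n :=
      (Finset.eventually_all _).mpr fun k hk =>
        hlim.eventually (lt_mem_nhds (hneg k (Finset.mem_Icc.mp hk).1))
    obtain ⟨K, h1, h2⟩ := ((eventually_ge_atTop L).and h).exists
    exact ⟨K, h1, h2⟩
  refine ⟨K, by omega, ?_⟩
  have hnear1 : ∀ᶠ p in 𝓝 p0, ∀ k ∈ Finset.Icc 2 L, s p k < s p K :=
    (Finset.eventually_all _).mpr fun k hk =>
      (continuous_s k).continuousAt.eventually_lt (continuous_s K).continuousAt (hK k hk)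
  have hnear2 : ∀ᶠ p in 𝓝 p0, ∀ k ∈ Finset.Icc 2 L, s p k < 0 :=
    (Finset.eventually_all _).mpr fun k hk =>
      (continuous_s k).continuousAt.eventually_lt continuousAt_const
        (hneg k (Finset.mem_Icc.mp hk).1)
  filter_upwards [hnear1, hnear2, lt_mem_nhds hrp, gt_mem_nhds hpR] with p hp3 hp4 hp5 hp6
  have hpos : 0 < p := by linarith
  have hstep : ∀ n, L ≤ n → s p n ≤ s p (n + 1) := by
    intro n hn
    have h1 := le_s_succ hpos.le (by linarith) n
    have h2 := s_le_pow hpos.le (by linarith) (by omega)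
      (fun k hk2 hkL => (hp4 k (Finset.mem_Icc.mpr ⟨hk2, hkL⟩)).le) hn n (by omega) le_rfl
    have h3 : 0 < p ^ (n + 1) := by positivity
    have h4 : p ^ (L + 1) ≤ R ^ (L + 1) := pow_le_pow_left₀ hpos.le hp6.le _
    have h4' : R ^ (L + 1) ≤ R ^ L := pow_le_pow_of_le_one (by linarith) hR.le (by omega)
    have h5 := (hL L le_rfl).1
    have h6 := (hL (n + 1) (by omega)).2
    rw [div_pow, div_lt_iff₀ (by positivity)] at h6
    have h7 : (1 - p) ^ (n + 1) ≤ (1 - r) ^ (n + 1) :=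
      pow_le_pow_left₀ (by linarith) (by linarith) _
    have h8 : r ^ (n + 1) ≤ p ^ (n + 1) := pow_le_pow_left₀ hr0.le hp5.le _
    nlinarith
  have hmono : ∀ k n, L ≤ k → k ≤ n → s p k ≤ s p n := by
    intro k n hk hkn
    induction n, hkn using Nat.le_induction with
    | base => exact le_rfl
    | succ n hn ih => exact ih.trans (hstep n (by omega))
  intro n hn k hk2 hkn
  rcases le_total k L with h | h
  · exact (hp3 k (Finset.mem_Icc.mpr ⟨hk2, h⟩)).le.trans (hmono K n hKL hn)
  · exact hmono k n h hkn

/-- Upper increment bound once `s p n` dominates its predecessors. -/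
theorem s_succ_sub_le {p : ℝ} (h0 : 0 ≤ p) (h1 : p ≤ 1) {n : ℕ} (hn : 2 ≤ n)
    (hdom : ∀ k, 2 ≤ k → k ≤ n → s p k ≤ s p n) :
    s p (n + 1) - s p n ≤ p ^ (n + 1) * (1 - p) + (n + 2) * p ^ n * |s p n| := by
  have hq : 0 ≤ (1 - p) ^ (n + 1) := pow_nonneg (by linarith) _
  have hpn : 0 ≤ p ^ n := by positivity
  rcases le_total (s p n) 0 with h | h
  · have h2 := s_succ_le_of_nonpos h0 h1 hn h hdom
    rw [abs_of_nonpos h]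
    have h3 : p ^ (n + 1) + (n + 1) * p ^ n * (1 - p) ≤ (n + 2) * p ^ n := by
      have : 0 ≤ (n + 1) * p ^ n * p := by positivity
      rw [pow_succ]
      nlinarith
    nlinarith [mul_le_mul_of_nonneg_right h3 (neg_nonneg.mpr h)]
  · have h2 := s_succ_le h0 h1 (n := n) (by omega) (M := s p n) fun k hk1 hk => by
      rcases (show k = 1 ∨ 2 ≤ k by omega) with rfl | hk2
      · rwa [s_one]
      · exact hdom k hk2 hk
    rw [abs_of_nonneg h]
    have h3 : 0 ≤ (n + 2) * p ^ n * s p n := by positivity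
    have h4 : 0 ≤ p ^ (n + 1) * s p n := by positivity
    linarith

/-- Lower increment bound. -/
theorem le_s_succ_sub {p : ℝ} (h0 : 0 ≤ p) (h1 : p ≤ 1) (n : ℕ) :
    p ^ (n + 1) * (1 - p) - (1 - p) ^ (n + 1) - (n + 2) * p ^ n * |s p n| ≤
      s p (n + 1) - s p n := by
  have h2 := le_s_succ h0 h1 n
  have hpn : 0 ≤ p ^ n := by positivity
  have h3 : p ^ (n + 1) * s p n ≤ (n + 2) * p ^ n * |s p n| := by
    have h4 : p ^ (n + 1) ≤ (n + 2) * p ^ n := by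
      have : 0 ≤ (n + 1) * p ^ n := by positivity
      rw [pow_succ]
      nlinarith
    calc p ^ (n + 1) * s p n ≤ p ^ (n + 1) * |s p n| := by gcongr; exact le_abs_self _
      _ ≤ (n + 2) * p ^ n * |s p n| := by gcongr
  linarith

/-- The expansion `S p - s p n ≈ p ^ (n + 1)`, uniform near a zero `p0` of the limit `S`. -/
theorem eventually_limit_sub_s_bounds {S : ℝ → ℝ} {p0 : ℝ} (hp0 : 1 / 2 < p0) (hp1 : p0 < 1)
    (hS : ∀ p : ℝ, 1 / 2 ≤ p → p ≤ 1 → Tendsto (fun n : ℕ => s p n) atTop (𝓝 (S p)))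
    (hz : S p0 = 0) {κ : ℝ} (hκ : 0 < κ) :
    ∃ N : ℕ, ∀ᶠ p in 𝓝 p0, ∀ n, N ≤ n →
      (1 - κ) * p ^ (n + 1) - κ * (|S p| + (S p - s p n)) ≤ S p - s p n ∧
      S p - s p n ≤ p ^ (n + 1) + κ * (|S p| + (S p - s p n)) := by
  have hlim : Tendsto (fun n => s p0 n) atTop (𝓝 0) := hz ▸ hS p0 hp0.le hp1.le
  obtain ⟨r, hr, hrp⟩ := exists_between hp0
  obtain ⟨R, hpR, hR⟩ := exists_between hp1
  have hr0 : 0 < r := by linarith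
  have hR0 : 0 < R := by linarith
  obtain ⟨K, hK2, hK⟩ := eventually_s_le_s hp0 hp1 hlim
  set w : ℕ → ℝ := fun k => (k + 2) * R ^ k with hw
  have hw0 : ∀ k, 0 ≤ w k := fun k => by positivity
  have hws : Summable w := by
    have hRn : ‖R‖ < 1 := by rwa [Real.norm_of_nonneg hR0.le]
    have h1 := summable_pow_mul_geometric_of_norm_lt_one 1 hRn
    have h2 := (summable_geometric_of_norm_lt_one hRn).mul_left 2
    refine (h1.add h2).congr fun k => ?_
    simp only [hw, pow_one]
    ring
  have hev1 : ∀ᶠ n : ℕ in atTop, ∑' k, w (k + n) < κ :=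
    (tendsto_sum_nat_add w).eventually (gt_mem_nhds hκ)
  have hev2 : ∀ᶠ n : ℕ in atTop, ((1 - r) / r) ^ n < κ * (1 - R) :=
    (tendsto_pow_atTop_nhds_zero_of_lt_one (div_nonneg (by linarith) hr0.le)
      ((div_lt_one hr0).mpr (by linarith))).eventually
        (gt_mem_nhds (mul_pos hκ (by linarith)))
  obtain ⟨N, hN⟩ := eventually_atTop.mp (hev1.and hev2)
  refine ⟨max K N, ?_⟩
  filter_upwards [hK, lt_mem_nhds hrp, gt_mem_nhds hpR] with p hp2 hp3 hp4 n hn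
  have hpos : 0 < p := by linarith
  have hKn : K ≤ n := (le_max_left _ _).trans hn
  have hNn : N ≤ n := (le_max_right _ _).trans hn
  have hSp := hS p (by linarith) (by linarith)
  have hleS : ∀ k, K ≤ k → s p k ≤ S p := fun k hk =>
    ge_of_tendsto hSp (eventually_atTop.mpr ⟨k, fun m hm => hp2 m (hk.trans hm) k (by omega) hm⟩)
  set B := |S p| + (S p - s p n) with hB
  have hB0 : 0 ≤ B := add_nonneg (abs_nonneg _) (sub_nonneg.mpr (hleS n hKn))
  have habs : ∀ k, n ≤ k → |s p k| ≤ B := by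
    intro k hk
    have h1 := hp2 k (hKn.trans hk) n (by omega) hk
    have h2 := hleS k (hKn.trans hk)
    have h3 := hleS n hKn
    have h4 := neg_abs_le (S p)
    have h5 := le_abs_self (S p)
    rw [abs_le]
    constructor <;> linarith
  have herr : ∀ k, n ≤ k → (k + 2) * p ^ k * |s p k| ≤ w k * B := by
    intro k hk
    have h1 := habs k hk
    have h2 : p ^ k ≤ R ^ k := pow_le_pow_left₀ hpos.le hp4.le _
    simp only [hw]
    gcongr
  have hq : ∀ k, n ≤ k → (1 - p) ^ (k + 1) ≤ κ * (p ^ (k + 1) * (1 - p)) := by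
    intro k hk
    have h6 := (hN (k + 1) (by omega)).2
    rw [div_pow, div_lt_iff₀ (by positivity)] at h6
    have h7 : (1 - p) ^ (k + 1) ≤ (1 - r) ^ (k + 1) :=
      pow_le_pow_left₀ (by linarith) (by linarith) _
    have h8 : r ^ (k + 1) ≤ p ^ (k + 1) := pow_le_pow_left₀ hr0.le hp3.le _
    have h9 : κ * (1 - R) * r ^ (k + 1) ≤ κ * (1 - p) * p ^ (k + 1) := by
      have : 0 ≤ 1 - p := by linarith
      gcongr
    linarith
  have hsum : ∀ m,
      (1 - κ) * (p ^ (n + 1) - p ^ (m + n + 1)) - (∑ k ∈ Finset.range m, w (k + n)) * B ≤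
        s p (m + n) - s p n ∧
      s p (m + n) - s p n ≤
        p ^ (n + 1) - p ^ (m + n + 1) + (∑ k ∈ Finset.range m, w (k + n)) * B := by
    intro m
    induction m with
    | zero => simp
    | succ m ih =>
      have h1 := s_succ_sub_le hpos.le (by linarith) (n := m + n) (by omega)
        (hp2 (m + n) (by omega))
      have h2 := le_s_succ_sub hpos.le (by linarith) (m + n)
      have h3 := herr (m + n) (by omega)
      have h4 := hq (m + n) (by omega)
      rw [Finset.sum_range_succ, add_right_comm m 1 n, pow_succ p (m + n + 1)]
      constructor <;> linarith [ih.1, ih.2]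
  have hsumκ : ∀ m, (∑ k ∈ Finset.range m, w (k + n)) * B ≤ κ * B := fun m =>
    mul_le_mul_of_nonneg_right ((((summable_nat_add_iff n).mpr hws).sum_le_tsum _
      fun k _ => hw0 _).trans (hN n hNn).1.le) hB0
  have hlim1 : Tendsto (fun m => s p (m + n) - s p n) atTop (𝓝 (S p - s p n)) :=
    ((tendsto_add_atTop_iff_nat n).mpr hSp).sub_const _
  have hpow : Tendsto (fun m : ℕ => p ^ (m + n + 1)) atTop (𝓝 0) := by
    simpa only [add_assoc] using (tendsto_add_atTop_iff_nat (n + 1)).mpr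
      (tendsto_pow_atTop_nhds_zero_of_lt_one hpos.le (by linarith))
  have hlim2 := ((hpow.const_sub (p ^ (n + 1))).const_mul (1 - κ)).sub_const (κ * B)
  rw [sub_zero] at hlim2
  constructor
  · exact le_of_tendsto_of_tendsto' hlim2 hlim1 fun m => by linarith [(hsum m).1, hsumκ m]
  · refine le_of_tendsto' hlim1 fun m => ?_
    have : 0 < p ^ (m + n + 1) := by positivity
    linarith [(hsum m).2, hsumκ m]

theorem lt_of_threshold_le {κ c L D P x : ℝ} (hκ0 : 0 < κ) (hκ1 : κ < 1 / 10)
    (hc : c = 1 - 10 * κ) (hP : 0 < P) (hL : L ≤ (1 + κ) * x) (hx : x ≤ c * c * P)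
    (hD : (1 - κ) * P - κ * (L + D) ≤ D) : L < D := by
  by_contra! h
  have h1 : (1 - κ) * P ≤ (1 + 2 * κ) * L := by nlinarith
  have h2 : L ≤ (1 + κ) * (c * c * P) := hL.trans (by gcongr)
  have h3 : (1 - κ) * P ≤ (1 + 2 * κ) * ((1 + κ) * (c * c * P)) := h1.trans (by gcongr)
  have h4 : c * c ≤ c := by nlinarith
  have h5 : (1 + 2 * κ) * ((1 + κ) * (c * c)) ≤ (1 + 2 * κ) * ((1 + κ) * c) := by gcongr
  have h6 : (1 + 2 * κ) * (1 + κ) ≤ 1 + 4 * κ := by nlinarith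
  have h7 : (1 + 2 * κ) * ((1 + κ) * c) ≤ (1 + 4 * κ) * c := by nlinarith
  have h8 : (1 + 4 * κ) * c < 1 - κ := by nlinarith
  have h9 := mul_lt_mul_of_pos_right (h5.trans_lt (h7.trans_lt h8)) hP
  linarith

theorem le_of_le_threshold {κ c L D P x : ℝ} (hκ0 : 0 < κ) (hκ1 : κ < 1 / 10)
    (hc : c = 1 - 10 * κ) (hx : 0 < x) (hL : (1 - κ) * x ≤ L) (hP : P ≤ c * x)
    (hD : D ≤ P + κ * (L + D)) : D ≤ L := by
  by_contra! h
  have h1 : (1 - 2 * κ) * L < P := by nlinarith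
  have h2 : (1 - 2 * κ) * ((1 - κ) * x) ≤ (1 - 2 * κ) * L :=
    mul_le_mul_of_nonneg_left hL (by linarith)
  have h3 : c ≤ (1 - 2 * κ) * (1 - κ) := by nlinarith
  have h4 := mul_le_mul_of_nonneg_right h3 hx.le
  linarith

theorem coin_game_np_asymptotics (S : ℝ → ℝ)
    (hS : ∀ p : ℝ, 1 / 2 ≤ p → p ≤ 1 →
      Filter.Tendsto (fun n : ℕ => s p n) Filter.atTop (nhds (S p)))
    (p0 : ℝ) (hp0l : 1 / 2 ≤ p0) (hp0u : p0 < 1) (hp0z : S p0 = 0)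
    (hp0uniq : ∀ q : ℝ, 1 / 2 ≤ q → q < 1 → S q = 0 → q = p0)
    (d : ℝ) (hd : HasDerivAt S d p0) (hdpos : 0 < d) :
    ∀ ε : ℝ, 0 < ε → ∃ δ : ℝ, 0 < δ ∧ ∀ p : ℝ, p0 < p → p < p0 + δ →
      ∃ m : ℕ, IsNp p m ∧
        (Real.log (p - p0) + Real.log d) / Real.log p0 - 1 - ε < (m : ℝ) ∧
        (m : ℝ) < (Real.log (p - p0) + Real.log d) / Real.log p0 + ε := by
  intro ε hε
  have hlim : Tendsto (fun n => s p0 n) atTop (𝓝 0) := hp0z ▸ hS p0 hp0l hp0u.le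
  have hp0h := half_lt_of_tendsto_zero hp0l hlim
  have hp0pos : 0 < p0 := by linarith
  have hlog : Real.log p0 < 0 := Real.log_neg hp0pos hp0u
  set c := Real.exp (ε / 2 * Real.log p0) with hc
  have hc0 : 0 < c := Real.exp_pos _
  have hc1 : c < 1 := Real.exp_lt_one_iff.mpr (mul_neg_of_pos_of_neg (half_pos hε) hlog)
  obtain ⟨κ, hκ⟩ : ∃ κ, κ = (1 - c) / 10 := ⟨_, rfl⟩
  have hκ0 : 0 < κ := by linarith
  have hκ1 : κ < 1 / 10 := by linarith
  have hκc : c = 1 - 10 * κ := by linarith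
  obtain ⟨N, hN⟩ := eventually_limit_sub_s_bounds hp0h hp0u hS hp0z hκ0
  have hneg : ∀ᶠ p in 𝓝 p0, ∀ k ∈ Finset.Icc 2 N, s p k < 0 :=
    (Finset.eventually_all _).mpr fun k hk =>
      (continuous_s k).continuousAt.eventually_lt continuousAt_const
        (s_neg_of_tendsto_zero hp0l hp0u hlim (Finset.mem_Icc.mp hk).1)
  have hder := (hasDerivAt_iff_isLittleO.mp hd).def (mul_pos hκ0 hdpos)
  set L : ℝ → ℝ := fun p => (Real.log (p - p0) + Real.log d) / Real.log p0 with hLdef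
  have hsub : Tendsto (fun p => p - p0) (𝓝[>] p0) (𝓝[>] 0) := by
    refine tendsto_nhdsWithin_iff.mpr ⟨?_, eventually_nhdsWithin_of_forall fun p hp => ?_⟩
    · have : Tendsto (fun p => p - p0) (𝓝 p0) (𝓝 (p0 - p0)) := tendsto_id.sub_const p0
      rw [sub_self] at this
      exact this.mono_left nhdsWithin_le_nhds
    · exact sub_pos.mpr (Set.mem_Ioi.mp hp)
  have hLtop : Tendsto L (𝓝[>] p0) atTop :=
    (tendsto_atBot_add_const_right _ (Real.log d)
      (Real.tendsto_log_nhdsGT_zero.comp hsub)).atBot_mul_const_of_neg (inv_lt_zero.mpr hlog)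
  have hLzero : Tendsto (fun p => (p - p0) / p0 * (L p + ε + 1)) (𝓝[>] p0) (𝓝 0) := by
    have h0 : Tendsto (fun p => p - p0) (𝓝[>] p0) (𝓝 0) :=
      hsub.mono_right nhdsWithin_le_nhds
    have h1 : Tendsto (fun p => (p - p0) * Real.log (p - p0)) (𝓝[>] p0) (𝓝 0) := by
      have h := (Real.continuous_mul_log.tendsto 0).comp h0
      rwa [zero_mul] at h
    have h2 := (h1.div_const (Real.log p0 * p0)).add
      (h0.mul_const ((Real.log d / Real.log p0 + ε + 1) / p0))
    simp only [zero_div, zero_mul, add_zero] at h2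
    refine h2.congr fun p => ?_
    simp only [hLdef]
    field_simp
    ring
  have hev : ∀ᶠ p in 𝓝[>] p0, ∃ m : ℕ, IsNp p m ∧ L p - 1 - ε < (m : ℝ) ∧ (m : ℝ) < L p + ε := by
    filter_upwards [nhdsWithin_le_nhds hN, nhdsWithin_le_nhds hneg, nhdsWithin_le_nhds hder,
      self_mem_nhdsWithin, hLtop.eventually_ge_atTop (N + 3),
      hLzero.eventually (gt_mem_nhds (show 0 < -(ε / 2 * Real.log p0) by nlinarith))]
      with p hp1 hp2 hp3 hp4 hp5 hp6
    have hη : 0 < p - p0 := sub_pos.mpr (Set.mem_Ioi.mp hp4)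
    have hp : 0 < p := by linarith
    have hLlog : L p * Real.log p0 = Real.log (d * (p - p0)) := by
      rw [Real.log_mul hdpos.ne' hη.ne', hLdef, div_mul_cancel₀ _ hlog.ne, add_comm]
    have hdη : 0 < d * (p - p0) := mul_pos hdpos hη
    have hexp : Real.exp (L p * Real.log p0) = d * (p - p0) := by
      rw [hLlog, Real.exp_log hdη]
    have hpow0 : ∀ n : ℕ, p0 ^ n = Real.exp (n * Real.log p0) := fun n => by
      rw [Real.exp_nat_mul, Real.exp_log hp0pos]
    have hcc : Real.exp (ε * Real.log p0) = c * c := by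
      rw [hc, ← Real.exp_add]
      ring_nf
    rw [hp0z, sub_zero, smul_eq_mul, Real.norm_eq_abs, Real.norm_of_nonneg hη.le, abs_le] at hp3
    have hS1 : (1 - κ) * (d * (p - p0)) ≤ S p := by linarith [hp3.1]
    have hS2 : S p ≤ (1 + κ) * (d * (p - p0)) := by linarith [hp3.2]
    have hS0 : 0 < S p := lt_of_lt_of_le (mul_pos (by linarith) hdη) hS1
    rw [abs_of_pos hS0] at hp1
    have hlower : ∀ n : ℕ, 2 ≤ n → 0 ≤ s p n → L p - 1 - ε < n := by
      intro n hn2 hsn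
      by_contra! hnL
      have hNn : N ≤ n := by
        by_contra! h
        exact absurd hsn (not_le.mpr (hp2 n (Finset.mem_Icc.mpr ⟨hn2, h.le⟩)))
      have h1 := (hp1 n hNn).1
      have h2 : d * (p - p0) ≤ c * c * p ^ (n + 1) := by
        calc d * (p - p0) ≤ Real.exp (ε * Real.log p0 + ((n + 1 : ℕ) : ℝ) * Real.log p0) := by
              rw [← hexp, Real.exp_le_exp]
              push_cast
              nlinarith
          _ = c * c * p0 ^ (n + 1) := by rw [Real.exp_add, hcc, hpow0]
          _ ≤ c * c * p ^ (n + 1) := by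
              have : p0 ≤ p := le_of_lt hp4
              gcongr
      have h3 := lt_of_threshold_le hκ0 hκ1 hκc (by positivity) hS2 h2 h1
      linarith
    have hupper : ∃ n : ℕ, 2 ≤ n ∧ 0 ≤ s p n ∧ (n : ℝ) < L p + ε := by
      have hceil : N + 3 ≤ ⌈L p + ε⌉₊ := by
        have h1 := Nat.le_ceil (L p + ε)
        have : ((N + 3 : ℕ) : ℝ) ≤ ⌈L p + ε⌉₊ := by
          push_cast
          linarith
        exact_mod_cast this
      obtain ⟨n, hn⟩ : ∃ n, ⌈L p + ε⌉₊ = n + 1 := ⟨⌈L p + ε⌉₊ - 1, by omega⟩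
      have hn1 : (n : ℝ) < L p + ε := Nat.lt_ceil.mp (by omega)
      have hn2 : L p + ε ≤ ((n + 1 : ℕ) : ℝ) := hn ▸ Nat.le_ceil _
      refine ⟨n, by omega, ?_, hn1⟩
      by_contra! hsn
      have h1 := (hp1 n (by omega)).2
      have h2 : p ^ (n + 1) ≤ c * (d * (p - p0)) := by
        have hratio : (p / p0) ^ (n + 1) ≤ Real.exp (-(ε / 2 * Real.log p0)) := by
          have h3 : p / p0 ≤ Real.exp ((p - p0) / p0) := by
            have h4 := Real.add_one_le_exp ((p - p0) / p0)
            have h5 : (p - p0) / p0 + 1 = p / p0 := by field_simp; ring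
            rwa [h5] at h4
          calc (p / p0) ^ (n + 1) ≤ Real.exp ((p - p0) / p0) ^ (n + 1) := by gcongr
            _ = Real.exp ((p - p0) / p0 * ((n : ℝ) + 1)) := by
                rw [← Real.exp_nat_mul]
                push_cast
                ring_nf
            _ ≤ Real.exp (-(ε / 2 * Real.log p0)) := by
                rw [Real.exp_le_exp]
                refine le_trans ?_ hp6.le
                gcongr
        calc p ^ (n + 1) = (p / p0) ^ (n + 1) * p0 ^ (n + 1) := by
              rw [div_pow]
              field_simp
          _ ≤ Real.exp (-(ε / 2 * Real.log p0)) *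
                Real.exp (ε * Real.log p0 + L p * Real.log p0) := by
              gcongr
              rw [hpow0, Real.exp_le_exp]
              nlinarith
          _ = c * (d * (p - p0)) := by
              rw [Real.exp_add, hcc, hexp, Real.exp_neg, ← hc]
              field_simp
      have h3 := le_of_le_threshold hκ0 hκ1 hκc hdη hS1 h2 h1
      linarith
    classical
    obtain ⟨n, hn2, hsn, hnL⟩ := hupper
    have hex : ∃ m, 2 ≤ m ∧ 0 ≤ s p m := ⟨n, hn2, hsn⟩
    obtain ⟨hm2, hm⟩ := Nat.find_spec hex
    refine ⟨Nat.find hex, ⟨hm2, hm, fun k hk2 hk => Nat.find_min' hex ⟨hk2, hk⟩⟩,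
      hlower _ hm2 hm, lt_of_le_of_lt ?_ hnL⟩
    exact_mod_cast Nat.find_min' hex ⟨hn2, hsn⟩
  obtain ⟨u, hu, hsubset⟩ := mem_nhdsGT_iff_exists_Ioo_subset.mp hev
  exact ⟨u - p0, sub_pos.mpr hu, fun p hpl hpu => hsubset ⟨hpl, by linarith⟩⟩
end
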